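/- arXiv:2605.10048 — 6 statements merged into one kernel-verified Lean document; each statement's English description precedes it below -/
import Mathlib

section
/- Fix positive integers N₁, N₂, M₁, M₂. As an identity of polynomials in the variables x₁,…,x_{N₁}, z₁,…,z_{N₁}, y₁,…,y_{N₂}, v₁,…,v_{N₂} over ℚ: ∑_{π¹ ⊆ [N₁,N₁,M₁]} ∑_{π² ⊆ [N₂,N₂,M₂]} P(π¹)·P(π²) · ∏_{i=1}^{N₁} x_i^{|π¹_{−i+1}|−|π¹_{−i}|} z_i^{|π¹_{i−1}|−|π¹_i|} · ∏_{j=1}^{N₂} y_j^{|π²_{−j+1}|−|π²_{−j}|} v_j^{|π²_{j−1}|−|π²_j|} = ∑_{μ¹ ⊆ [N₁,M₁]} ∑_{μ² ⊆ [N₂,M₂]} 2^{−l(μ¹)−l(μ²)} · F_{μ¹}(x₁,…,x_{N₁}) F_{μ¹}(z₁,…,z_{N₁}) · F_{μ²}(y₁,…,y_{N₂}) F_{μ²}(v₁,…,v_{N₂}), where the outer sums run over strict plane partitions confined to the indicated boxes and over strict partitions confined to the indicated rectangles. -/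
open scoped Classical

noncomputable section

namespace PaperIB

/-- A strict partition, encoded by the (0-indexed) sequence of its parts:
strictly decreasing while positive, and zero after the first zero. -/
def IsSP (μ : ℕ → ℕ) : Prop :=
  (∀ i, 0 < μ i → μ (i + 1) < μ i) ∧ (∀ i, μ i = 0 → μ (i + 1) = 0)

/-- `l(μ)`: the number of parts. -/
def len (μ : ℕ → ℕ) : ℕ := Set.ncard {i | 0 < μ i}

/-- `|μ|`: the weight (sum of the parts). -/
def wt (μ : ℕ → ℕ) : ℕ := ∑ᶠ i, μ i

/-- `#(μ|ν)`: the number of parts of `μ` that are not parts of `ν`. -/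
def dpart (μ ν : ℕ → ℕ) : ℕ := Set.ncard {p | 0 < p ∧ (∃ i, μ i = p) ∧ ∀ j, ν j ≠ p}

/-- Interlacing `μ ≻ ν`, i.e. `μ₁ ≥ ν₁ ≥ μ₂ ≥ ν₂ ≥ ⋯`. -/
def Ilace (μ ν : ℕ → ℕ) : Prop := ∀ i, ν i ≤ μ i ∧ μ (i + 1) ≤ ν i

/-- A strict plane partition: a two-sided sequence of strict partitions (the diagonal
slices), all but finitely many empty, interlacing towards the `0`-th slice. -/
def IsSPP (π : ℤ → ℕ → ℕ) : Prop :=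
  (∀ k, IsSP (π k)) ∧ (∀ k : ℤ, k < 0 → Ilace (π (k + 1)) (π k)) ∧
    (∀ k : ℤ, 0 < k → Ilace (π (k - 1)) (π k)) ∧ {k : ℤ | π k ≠ fun _ => 0}.Finite

/-- `|π|`: the weight of a strict plane partition. -/
def wtP (π : ℤ → ℕ → ℕ) : ℕ := ∑ᶠ k, wt (π k)

/-- The path weight
`P(π) = 2^{-l(π₀)} · ∏_{k≥1} 2^{#(π_{-k+1}|π_{-k})} · ∏_{k≥1} 2^{#(π_{k-1}|π_k)}`. -/
def pw (π : ℤ → ℕ → ℕ) : ℚ :=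
  (2 : ℚ) ^ (-(len (π 0) : ℤ)) *
    (∏ᶠ k : ℕ, (2 : ℚ) ^ dpart (π (-(k : ℤ))) (π (-(k : ℤ) - 1))) *
    ∏ᶠ k : ℕ, (2 : ℚ) ^ dpart (π (k : ℤ)) (π ((k : ℤ) + 1))

/-- Confinement of a strict plane partition to the box `[N,N,M]`. -/
def BoxedPP (π : ℤ → ℕ → ℕ) (N M : ℕ) : Prop :=
  IsSPP π ∧ (∀ k : ℤ, (N : ℤ) ≤ |k| → π k = fun _ => 0) ∧ ∀ k i, π k i ≤ M

/-- Confinement of a strict plane partition to `[N,N,∞]`. -/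
def BoxedPPInf (π : ℤ → ℕ → ℕ) (N : ℕ) : Prop :=
  IsSPP π ∧ ∀ k : ℤ, (N : ℤ) ≤ |k| → π k = fun _ => 0

/-- A strict partition confined to the rectangle `[N,M]`: at most `N` parts, each `≤ M`. -/
def InBoxSP (μ : ℕ → ℕ) (N M : ℕ) : Prop := IsSP μ ∧ len μ ≤ N ∧ ∀ i, μ i ≤ M

/-- A chain of interlacing strict partitions `μ = κ₀ ≻ κ₁ ≻ ⋯ ≻ κ_N = ∅`. -/
def IsChain (μ : ℕ → ℕ) (N : ℕ) (κ : Fin (N + 1) → ℕ → ℕ) : Prop :=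
  (∀ i, IsSP (κ i)) ∧ κ 0 = μ ∧ κ (Fin.last N) = (fun _ => 0) ∧
    ∀ i : Fin N, Ilace (κ i.castSucc) (κ i.succ)

/-- `F_μ(x₁,…,x_N) = ∑_{μ = κ₀ ≻ ⋯ ≻ κ_N = ∅} ∏ᵢ 2^{#(κ_{i-1}|κ_i)} xᵢ^{|κ_{i-1}|-|κ_i|}`. -/
def F (μ : ℕ → ℕ) (N : ℕ) (x : Fin N → ℚ) : ℚ :=
  ∑ᶠ κ ∈ {κ : Fin (N + 1) → ℕ → ℕ | IsChain μ N κ},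
    ∏ i : Fin N,
      (2 : ℚ) ^ dpart (κ i.castSucc) (κ i.succ) * x i ^ (wt (κ i.castSucc) - wt (κ i.succ))


lemma isSP_bound {μ : ℕ → ℕ} (h : IsSP μ) (i : ℕ) : μ i = 0 ∨ μ i + i ≤ μ 0 := by
  induction i with
  | zero => right; simp
  | succ i ih =>
    have h1 := h.1 i
    have h2 := h.2 i
    omega

lemma finite_SP (M : ℕ) : {μ : ℕ → ℕ | IsSP μ ∧ ∀ i, μ i ≤ M}.Finite := by
  have hfin : (Set.univ : Set (Fin (M + 1) → Fin (M + 1))).Finite := Set.finite_univ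
  refine Set.Finite.of_finite_image (f := fun μ : ℕ → ℕ => fun i : Fin (M + 1) =>
    (Fin.ofNat (M + 1) (μ i))) (hfin.subset (Set.subset_univ _)) ?_
  rintro μ ⟨h1, h2⟩ ν ⟨h3, h4⟩ h
  funext i
  by_cases hi : i < M + 1
  · have := congrArg Fin.val (congrFun h ⟨i, hi⟩)
    simp only [Fin.ofNat] at this
    rwa [Nat.mod_eq_of_lt (by have := h2 i; omega), Nat.mod_eq_of_lt (by have := h4 i; omega)]
      at this
  · have a := isSP_bound h1 i
    have b := isSP_bound h3 i
    have := h2 0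
    have := h4 0
    omega

lemma chain_le {μ : ℕ → ℕ} {N : ℕ} {κ : Fin (N + 1) → ℕ → ℕ} (h : IsChain μ N κ)
    (k : Fin (N + 1)) (i : ℕ) : κ k i ≤ μ i := by
  induction k using Fin.induction with
  | zero => rw [h.2.1]
  | succ k ih => exact ((h.2.2.2 k i).1).trans ih

lemma finite_chain {μ : ℕ → ℕ} {N M : ℕ} (hμ : ∀ i, μ i ≤ M) :
    {κ : Fin (N + 1) → ℕ → ℕ | IsChain μ N κ}.Finite := by
  refine (Set.Finite.pi' (fun _ : Fin (N + 1) => finite_SP M)).subset ?_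
  intro κ h k
  exact ⟨h.1 k, fun i => (chain_le h k i).trans (hμ i)⟩

lemma finite_box (N M : ℕ) : {μ : ℕ → ℕ | InBoxSP μ N M}.Finite :=
  (finite_SP M).subset fun _ h => ⟨h.1, h.2.2⟩

/-- The weight of a chain. -/
def cw (N : ℕ) (x : Fin N → ℚ) (κ : Fin (N + 1) → ℕ → ℕ) : ℚ :=
  ∏ i : Fin N,
      (2 : ℚ) ^ dpart (κ i.castSucc) (κ i.succ) * x i ^ (wt (κ i.castSucc) - wt (κ i.succ))

lemma F_eq (N : ℕ) (x : Fin N → ℚ) (μ : ℕ → ℕ) :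
    F μ N x = ∑ᶠ κ ∈ {κ : Fin (N + 1) → ℕ → ℕ | IsChain μ N κ}, cw N x κ := rfl

/-- Pairs of chains from the same partition. -/
def T (N M : ℕ) : Set (Σ _ : ℕ → ℕ, (Fin (N + 1) → ℕ → ℕ) × (Fin (N + 1) → ℕ → ℕ)) :=
  {t | InBoxSP t.1 N M ∧ IsChain t.1 N t.2.1 ∧ IsChain t.1 N t.2.2}

lemma T_finite (N M : ℕ) : (T N M).Finite := by
  have h : {κ : Fin (N + 1) → ℕ → ℕ | ∀ k, κ k ∈ {μ : ℕ → ℕ | IsSP μ ∧ ∀ i, μ i ≤ M}}.Finite :=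
    Set.Finite.pi' (fun _ => finite_SP M)
  refine (((finite_box N M).toFinset.sigma fun _ =>
    h.toFinset ×ˢ h.toFinset).finite_toSet).subset ?_
  rintro ⟨μ, κ, κ'⟩ ⟨h1, h2, h3⟩
  simp only [Finset.coe_sigma, Set.mem_sigma_iff, Finset.mem_coe, Finset.mem_product,
    Set.Finite.mem_toFinset, Set.mem_ofPred_eq]
  exact ⟨h1, fun k => ⟨h2.1 k, fun i => (chain_le h2 k i).trans (h1.2.2 i)⟩,
    fun k => ⟨h3.1 k, fun i => (chain_le h3 k i).trans (h1.2.2 i)⟩⟩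

lemma rhs_eq (N M : ℕ) (x z : Fin N → ℚ) :
    ∑ᶠ t ∈ T N M, (2 : ℚ) ^ (-(len t.1 : ℤ)) * (cw N x t.2.1 * cw N z t.2.2) =
    ∑ᶠ μ ∈ {μ : ℕ → ℕ | InBoxSP μ N M}, (2 : ℚ) ^ (-(len μ : ℤ)) * (F μ N x * F μ N z) := by
  have key : ∀ μ : ℕ → ℕ, ∃ C : Finset (Fin (N + 1) → ℕ → ℕ),
      InBoxSP μ N M → ∀ κ, κ ∈ C ↔ IsChain μ N κ := by
    intro μ
    by_cases h : InBoxSP μ N M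
    · exact ⟨(finite_chain (N := N) h.2.2).toFinset, fun _ κ => by simp⟩
    · exact ⟨∅, fun h' => absurd h' h⟩
  choose C hC using key
  have hT : T N M = ↑((finite_box N M).toFinset.sigma fun μ => C μ ×ˢ C μ) := by
    ext ⟨μ, κ, κ'⟩
    simp only [Finset.coe_sigma, Set.mem_sigma_iff, Finset.mem_coe, Finset.mem_product,
      Set.Finite.mem_toFinset, Set.mem_ofPred_eq, T]
    constructor
    · rintro ⟨h, h1, h2⟩
      exact ⟨h, (hC μ h κ).2 h1, (hC μ h κ').2 h2⟩
    · rintro ⟨h, h1, h2⟩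
      exact ⟨h, (hC μ h κ).1 h1, (hC μ h κ').1 h2⟩
  rw [hT, finsum_mem_coe_finset, Finset.sum_sigma, finsum_mem_eq_finite_toFinset_sum _
    (finite_box N M)]
  refine Finset.sum_congr rfl fun μ hμ => ?_
  have hμ' : InBoxSP μ N M := by simpa using hμ
  have hF : ∀ w, F μ N w = ∑ κ ∈ C μ, cw N w κ := by
    intro w
    rw [F_eq, ← finsum_mem_coe_finset]
    congr 1
    funext κ
    have : κ ∈ {κ : Fin (N + 1) → ℕ → ℕ | IsChain μ N κ} ↔ κ ∈ (↑(C μ) : Set _) := by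
      simp [hC μ hμ' κ]
    rw [this]
  rw [hF, hF, Finset.sum_mul_sum, ← Finset.sum_product', Finset.mul_sum]

lemma dpart_zero : dpart (fun _ => 0) (fun _ => 0) = 0 := by
  unfold dpart
  convert Set.ncard_empty ℕ
  ext p
  simp <;> omega

lemma pw_eq {π : ℤ → ℕ → ℕ} {N M : ℕ} (h : BoxedPP π N M) :
    pw π = (2 : ℚ) ^ (-(len (π 0) : ℤ)) *
      (∏ k : Fin N, (2 : ℚ) ^ dpart (π (-((k : ℕ) : ℤ))) (π (-((k : ℕ) : ℤ) - 1))) *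
      ∏ k : Fin N, (2 : ℚ) ^ dpart (π ((k : ℕ) : ℤ)) (π (((k : ℕ) : ℤ) + 1)) := by
  unfold pw
  rw [finprod_eq_prod_of_mulSupport_subset (s := Finset.range N),
    finprod_eq_prod_of_mulSupport_subset (s := Finset.range N), Finset.prod_range,
    Finset.prod_range]
  · intro k hk
    by_contra hk'
    simp only [Finset.coe_range, Set.mem_Iio, not_lt] at hk'
    apply hk
    dsimp only
    rw [h.2.1 k (by rw [le_abs]; omega), h.2.1 (k + 1) (by rw [le_abs]; omega), dpart_zero,
      pow_zero]
  · intro k hk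
    by_contra hk'
    simp only [Finset.coe_range, Set.mem_Iio, not_lt] at hk'
    apply hk
    dsimp only
    rw [h.2.1 (-k) (by rw [le_abs]; omega), h.2.1 (-k - 1) (by rw [le_abs]; omega), dpart_zero,
      pow_zero]

/-- Splitting a plane partition into two chains. -/
def g (N : ℕ) (π : ℤ → ℕ → ℕ) :
    Σ _ : ℕ → ℕ, (Fin (N + 1) → ℕ → ℕ) × (Fin (N + 1) → ℕ → ℕ) :=
  ⟨π 0, fun i => π (-((i : ℕ) : ℤ)), fun i => π ((i : ℕ) : ℤ)⟩

lemma len_le {π : ℤ → ℕ → ℕ} {N M : ℕ} (h : BoxedPP π N M) : len (π 0) ≤ N := by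
  have key : ∀ j : ℕ, j ≤ N → ∀ i, j ≤ i → π ((N : ℤ) - j) i = 0 := by
    intro j
    induction j with
    | zero =>
      intro _ i _
      rw [h.2.1 _ (by rw [le_abs]; simp)]
    | succ j ih =>
      intro hj i hi
      have h1 := (h.1.2.2.1 ((N : ℤ) - j) (by omega) (i - 1)).2
      rw [ih (by omega) (i - 1) (by omega), Nat.sub_add_cancel (by omega)] at h1
      have e : (N : ℤ) - ((j + 1 : ℕ) : ℤ) = (N : ℤ) - j - 1 := by push_cast; ring
      rw [e]
      omega
  have hs : {i | 0 < π 0 i} ⊆ (↑(Finset.range N) : Set ℕ) := by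
    intro i hi
    by_contra hi'
    simp only [Finset.coe_range, Set.mem_Iio, not_lt] at hi'
    have := key N le_rfl i hi'
    rw [sub_self] at this
    simp only [Set.mem_ofPred_eq] at hi
    omega
  have := Set.ncard_le_ncard hs (Finset.finite_toSet _)
  rwa [Set.ncard_coe_finset, Finset.card_range] at this

lemma g_bij (N M : ℕ) : Set.BijOn (g N) {π | BoxedPP π N M} (T N M) := by
  refine ⟨?_, ?_, ?_⟩
  · intro π h
    have h : BoxedPP π N M := h
    refine ⟨⟨h.1.1 0, len_le h, h.2.2 0⟩, ⟨fun i => h.1.1 _, ?_, ?_, ?_⟩,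
      ⟨fun i => h.1.1 _, ?_, ?_, ?_⟩⟩
    · simp [g]
    · exact h.2.1 _ (by rw [le_abs]; simp)
    · intro i
      have := h.1.2.1 (-((i : ℕ) : ℤ) - 1) (by omega)
      rw [sub_add_cancel] at this
      simp only [g, Fin.val_castSucc, Fin.val_succ]
      convert this using 2
      push_cast; ring
    · simp [g]
    · exact h.2.1 _ (by rw [le_abs]; simp)
    · intro i
      have := h.1.2.2.1 (((i : ℕ) : ℤ) + 1) (by omega)
      rw [add_sub_cancel_right] at this
      simp only [g, Fin.val_castSucc, Fin.val_succ]
      convert this using 2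
      push_cast; rfl
  · intro π h π' h' he
    have h : BoxedPP π N M := h
    have h' : BoxedPP π' N M := h'
    simp only [g, Sigma.mk.injEq, heq_eq_eq, Prod.mk.injEq] at he
    obtain ⟨-, e1, e2⟩ := he
    funext k
    by_cases hk : (N : ℤ) ≤ |k|
    · rw [h.2.1 k hk, h'.2.1 k hk]
    · rw [le_abs, not_or] at hk
      rcases le_total k 0 with h0 | h0
      · have := congrFun e1 ⟨(-k).toNat, by omega⟩
        simp only at this
        rwa [show -(((-k).toNat : ℕ) : ℤ) = k by omega] at this
      · have := congrFun e2 ⟨k.toNat, by omega⟩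
        simp only at this
        rwa [show ((k.toNat : ℕ) : ℤ) = k by omega] at this
  · rintro ⟨μ, κ, κ'⟩ ⟨h1, h2, h3⟩
    simp only at h1 h2 h3
    -- extend chains by zero
    have ext : ∀ κ : Fin (N + 1) → ℕ → ℕ, IsChain μ N κ → ∃ c : ℕ → ℕ → ℕ,
        (∀ i : Fin (N + 1), c i = κ i) ∧ c 0 = μ ∧ (∀ n, N ≤ n → c n = fun _ => 0) ∧
        (∀ n, IsSP (c n)) ∧ (∀ n i, c n i ≤ M) ∧ ∀ n, Ilace (c n) (c (n + 1)) := by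
      intro κ h
      have hz : IsSP (fun _ => 0) := ⟨by simp, by simp⟩
      refine ⟨fun n => if hn : n < N + 1 then κ ⟨n, hn⟩ else fun _ => 0, ?_, ?_, ?_, ?_, ?_, ?_⟩
      · intro i
        dsimp only
        rw [dif_pos i.isLt]
      · have := h.2.1
        simpa using this
      · intro n hn
        by_cases h' : n < N + 1
        · have : n = N := by omega
          subst this
          have := h.2.2.1
          simpa [Fin.last] using this
        · simp [h']
      · intro n
        dsimp only
        split_ifs with hn
        · exact h.1 _
        · exact hz
      · intro n i
        dsimp only
        split_ifs with hn
        · exact (chain_le h _ i).trans (h1.2.2 i)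
        · simp
      · intro n
        by_cases hn : n < N
        · have := h.2.2.2 ⟨n, hn⟩
          have a : n < N + 1 := by omega
          simpa [hn, a] using this
        · by_cases h' : n < N + 1
          · have : n = N := by omega
            subst this
            have := h.2.2.1
            simp only [Fin.last] at this
            intro i
            simp [this]
          · intro i
            simp [h', hn]
    obtain ⟨c, c1, c2, c3, c4, c5, c6⟩ := ext κ h2
    obtain ⟨d, d1, d2, d3, d4, d5, d6⟩ := ext κ' h3
    refine ⟨fun k => if k ≤ 0 then c (-k).toNat else d k.toNat, ?_, ?_⟩
    · have hzero : ∀ k : ℤ, (N : ℤ) ≤ |k| →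
          (if k ≤ 0 then c (-k).toNat else d k.toNat) = fun _ => 0 := by
        intro k hk
        rw [le_abs] at hk
        split_ifs with h0
        · exact c3 _ (by omega)
        · exact d3 _ (by omega)
      refine ⟨⟨?_, ?_, ?_, ?_⟩, hzero, ?_⟩
      · intro k
        dsimp only
        split_ifs
        · exact c4 _
        · exact d4 _
      · intro k hk
        have := c6 (-(k + 1)).toNat
        rw [show (-(k + 1)).toNat + 1 = (-k).toNat by omega] at this
        dsimp only
        rwa [if_pos (by omega), if_pos (by omega)]
      · intro k hk
        have := d6 (k - 1).toNat
        rw [show (k - 1).toNat + 1 = k.toNat by omega] at this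
        dsimp only
        rw [if_neg (show ¬ k ≤ 0 by omega)]
        split_ifs with h0
        · have : k = 1 := by omega
          subst this
          simp only [sub_self, neg_zero, Int.toNat_zero, d2, c2] at this ⊢
          exact this
        · exact this
      · refine (Set.finite_Icc (-(N : ℤ)) N).subset ?_
        intro k hk
        by_contra hk'
        apply hk
        apply hzero
        rw [Set.mem_Icc] at hk'
        rw [le_abs]
        omega
      · intro k i
        dsimp only
        split_ifs
        · exact c5 _ _
        · exact d5 _ _
    · have e1 : (fun i : Fin (N + 1) => if (-((i : ℕ) : ℤ)) ≤ 0 then c (-(-((i : ℕ) : ℤ))).toNat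
          else d (-((i : ℕ) : ℤ)).toNat) = κ := by
        funext i
        rw [if_pos (by omega), neg_neg, Int.toNat_natCast, c1]
      have e2 : (fun i : Fin (N + 1) => if (((i : ℕ) : ℤ)) ≤ 0 then c (-((i : ℕ) : ℤ)).toNat
          else d (((i : ℕ) : ℤ)).toNat) = κ' := by
        funext i
        rw [← d1 i]
        split_ifs with h0
        · have : (i : ℕ) = 0 := by omega
          rw [this]
          simp [c2, d2]
        · simp
      simp only [g]
      rw [e1, e2]
      simp [c2]

/-- One-component summand. -/
def sw (N : ℕ) (x z : Fin N → ℚ) (π : ℤ → ℕ → ℕ) : ℚ :=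
  pw π * ∏ i : Fin N, x i ^ (wt (π (-((i : ℕ) : ℤ))) - wt (π (-((i : ℕ) : ℤ) - 1))) *
              z i ^ (wt (π ((i : ℕ) : ℤ)) - wt (π (((i : ℕ) : ℤ) + 1)))

lemma single (N M : ℕ) (x z : Fin N → ℚ) :
    ∑ᶠ π ∈ {π | BoxedPP π N M}, sw N x z π =
    ∑ᶠ μ ∈ {μ : ℕ → ℕ | InBoxSP μ N M}, (2 : ℚ) ^ (-(len μ : ℤ)) * (F μ N x * F μ N z) := by
  rw [← rhs_eq]
  refine finsum_mem_eq_of_bijOn (g N) (g_bij N M) ?_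
  intro π h
  have h : BoxedPP π N M := h
  rw [sw, pw_eq h]
  simp only [g, cw, Fin.val_castSucc, Fin.val_succ, Finset.prod_mul_distrib]
  have e : ∀ i : Fin N, -((((i : ℕ) + 1 : ℕ)) : ℤ) = -((i : ℕ) : ℤ) - 1 := by
    intro i; push_cast; ring
  simp only [e]
  simp only [Nat.cast_add, Nat.cast_one]
  ring

lemma finsum_pair {α β : Type*} {s : Set α} {t : Set β} (hs : s.Finite) (ht : t.Finite)
    (f : α → ℚ) (h : β → ℚ) :
    ∑ᶠ p ∈ {p : α × β | p.1 ∈ s ∧ p.2 ∈ t}, f p.1 * h p.2 =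
      (∑ᶠ a ∈ s, f a) * ∑ᶠ b ∈ t, h b := by
  have : {p : α × β | p.1 ∈ s ∧ p.2 ∈ t} = ↑(hs.toFinset ×ˢ ht.toFinset) := by
    ext p; simp
  rw [this, finsum_mem_coe_finset, finsum_mem_eq_finite_toFinset_sum _ hs,
    finsum_mem_eq_finite_toFinset_sum _ ht, Finset.sum_mul_sum, ← Finset.sum_product']

lemma finite_boxed (N M : ℕ) : {π | BoxedPP π N M}.Finite :=
  Set.Finite.of_finite_image ((g_bij N M).image_eq ▸ T_finite N M) (g_bij N M).injOn

/-- The scalar product of the generalized i-boson model: the generating function for boxed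
BUC plane partitions equals a sum of products of the (Schur-Q) polynomials `F_μ`. -/
theorem stmt2 (N₁ N₂ M₁ M₂ : ℕ) (hN₁ : 0 < N₁) (hN₂ : 0 < N₂) (hM₁ : 0 < M₁) (hM₂ : 0 < M₂)
    (x z : Fin N₁ → ℚ) (y v : Fin N₂ → ℚ) :
    (∑ᶠ π ∈ {π : (ℤ → ℕ → ℕ) × (ℤ → ℕ → ℕ) | BoxedPP π.1 N₁ M₁ ∧ BoxedPP π.2 N₂ M₂},
        pw π.1 * pw π.2 *
          (∏ i : Fin N₁,
            x i ^ (wt (π.1 (-((i : ℕ) : ℤ))) - wt (π.1 (-((i : ℕ) : ℤ) - 1))) *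
              z i ^ (wt (π.1 ((i : ℕ) : ℤ)) - wt (π.1 (((i : ℕ) : ℤ) + 1)))) *
          ∏ j : Fin N₂,
            y j ^ (wt (π.2 (-((j : ℕ) : ℤ))) - wt (π.2 (-((j : ℕ) : ℤ) - 1))) *
              v j ^ (wt (π.2 ((j : ℕ) : ℤ)) - wt (π.2 (((j : ℕ) : ℤ) + 1))))
      =
    ∑ᶠ μ ∈ {μ : (ℕ → ℕ) × (ℕ → ℕ) | InBoxSP μ.1 N₁ M₁ ∧ InBoxSP μ.2 N₂ M₂},
        (2 : ℚ) ^ (-((len μ.1 : ℤ) + (len μ.2 : ℤ))) *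
          (F μ.1 N₁ x * F μ.1 N₁ z) * (F μ.2 N₂ y * F μ.2 N₂ v) := by
  have h1 := finsum_pair (finite_boxed N₁ M₁) (finite_boxed N₂ M₂) (sw N₁ x z) (sw N₂ y v)
  have h2 := finsum_pair (finite_box N₁ M₁) (finite_box N₂ M₂)
    (fun μ => (2 : ℚ) ^ (-(len μ : ℤ)) * (F μ N₁ x * F μ N₁ z))
    (fun μ => (2 : ℚ) ^ (-(len μ : ℤ)) * (F μ N₂ y * F μ N₂ v))
  rw [single, single, ← h2] at h1
  refine Eq.trans ?_ (h1.trans ?_)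
  · refine finsum_mem_congr rfl fun p _ => ?_
    simp only [sw]
    ring
  · refine finsum_mem_congr rfl fun p _ => ?_
    rw [neg_add, zpow_add₀ (by norm_num)]
    ring

end PaperIB
end
end

section
/- For every strict partition μ and every positive integer N, the polynomial F_μ(x₁,…,x_N) is symmetric: for every permutation σ of {1,…,N}, F_μ(x_{σ(1)},…,x_{σ(N)}) = F_μ(x₁,…,x_N). -/
open scoped Classical

noncomputable section

namespace PaperIB

set_option linter.all false
set_option linter.unusedSimpArgs false
set_option linter.unusedVariables false

/-- Prepend a part. -/
def pcons (m : ℕ) (κ : ℕ → ℕ) : ℕ → ℕ := fun i => Nat.casesOn i m κ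

lemma pcons_zero (m : ℕ) (κ : ℕ → ℕ) : pcons m κ 0 = m := rfl
lemma pcons_succ (m : ℕ) (κ : ℕ → ℕ) (i : ℕ) : pcons m κ (i + 1) = κ i := rfl

lemma pcons_inj (m : ℕ) : Function.Injective (pcons m) := by
  intro a b h
  funext i
  exact congrFun h (i + 1)

/-- Strict partitions with parts at most `n`. -/
def Tf : ℕ → Finset (ℕ → ℕ)
  | 0 => {fun _ => 0}
  | n + 1 => Tf n ∪ (Tf n).image (pcons (n + 1))

lemma mem_Tf (n : ℕ) : ∀ κ : ℕ → ℕ, κ ∈ Tf n ↔ IsSP κ ∧ κ 0 ≤ n := by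
  induction n with
  | zero =>
    intro κ
    simp only [Tf, Finset.mem_singleton]
    constructor
    · rintro rfl
      simp [IsSP]
    · rintro ⟨⟨_, h2⟩, h⟩
      funext i
      induction i with
      | zero => omega
      | succ i ih => exact h2 i ih
  | succ n ih =>
    intro κ
    simp only [Tf, Finset.mem_union, Finset.mem_image, ih]
    constructor
    · rintro (⟨h, h'⟩ | ⟨κ', ⟨⟨h1, h2⟩, h'⟩, rfl⟩)
      · exact ⟨h, by omega⟩
      · refine ⟨⟨?_, ?_⟩, le_refl _⟩
        · intro i
          cases i with
          | zero => intro _; rw [pcons_succ, pcons_zero]; omega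
          | succ i => exact h1 i
        · intro i
          cases i with
          | zero => intro h; rw [pcons_zero] at h; omega
          | succ i => exact h2 i
    · rintro ⟨⟨h1, h2⟩, h⟩
      by_cases hn : κ 0 ≤ n
      · exact Or.inl ⟨⟨h1, h2⟩, hn⟩
      · right
        refine ⟨fun i => κ (i + 1), ⟨⟨fun i => h1 (i + 1), fun i => h2 (i + 1)⟩, ?_⟩, ?_⟩
        · have := h1 0 (by omega)
          simp only [zero_add] at *
          omega
        · funext i
          cases i with
          | zero => rw [pcons_zero]; omega
          | succ i => rfl

lemma Tf_le {n : ℕ} {κ : ℕ → ℕ} (h : κ ∈ Tf n) : ∀ i, κ i ≤ n - i := by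
  obtain ⟨⟨h1, h2⟩, h0⟩ := (mem_Tf n κ).1 h
  intro i
  induction i with
  | zero => exact h0
  | succ i ih =>
    rcases Nat.eq_zero_or_pos (κ i) with hz | hp
    · rw [h2 i hz]; omega
    · have := h1 i hp; omega

lemma Tf_le' {n : ℕ} {κ : ℕ → ℕ} (h : κ ∈ Tf n) (i : ℕ) : κ i ≤ n := by
  have := Tf_le h i; omega

lemma wt_eq {n : ℕ} {κ : ℕ → ℕ} (h : κ ∈ Tf n) (N : ℕ) (hN : n ≤ N) :
    wt κ = ∑ i ∈ Finset.range N, κ i := by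
  unfold wt
  apply finsum_eq_sum_of_support_subset
  intro i hi
  have := Tf_le h i
  simp only [Function.mem_support] at hi
  simp only [Finset.coe_range, Set.mem_Iio]
  omega

lemma Tf_succ_left {n : ℕ} {κ : ℕ → ℕ} (h : κ ∈ Tf n) : κ ∈ Tf (n + 1) := by
  simp [Tf, h]

lemma Tf_succ_right {n : ℕ} {κ : ℕ → ℕ} (h : κ ∈ Tf n) : pcons (n + 1) κ ∈ Tf (n + 1) := by
  simp only [Tf, Finset.mem_union, Finset.mem_image]
  exact Or.inr ⟨κ, h, rfl⟩

lemma wt_pcons {n : ℕ} {κ : ℕ → ℕ} (h : κ ∈ Tf n) : wt (pcons (n + 1) κ) = wt κ + (n + 1) := by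
  rw [wt_eq (Tf_succ_right h) (n + 1) le_rfl, wt_eq h n le_rfl, Finset.sum_range_succ']
  rfl

lemma wt_le_of_Ilace {n : ℕ} {μ κ : ℕ → ℕ} (hμ : μ ∈ Tf n) (hκ : κ ∈ Tf n) (h : Ilace μ κ) :
    wt κ ≤ wt μ := by
  rw [wt_eq hμ n le_rfl, wt_eq hκ n le_rfl]
  exact Finset.sum_le_sum fun i _ => (h i).1

lemma wt_le_add_of_Ilace {n : ℕ} {μ κ : ℕ → ℕ} (hμ : μ ∈ Tf n) (hκ : κ ∈ Tf n)
    (h : Ilace κ μ) : wt κ ≤ n + wt μ := by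
  rw [wt_eq hμ n le_rfl, wt_eq hκ (n + 1) (by omega), Finset.sum_range_succ']
  have := Finset.sum_le_sum (s := Finset.range n) fun i _ => (h i).2
  have := Tf_le' hκ 0
  omega

lemma dpart_cons_none {n : ℕ} {μ κ : ℕ → ℕ} (hμ : μ ∈ Tf n) (hκ : κ ∈ Tf n) :
    dpart (pcons (n + 1) μ) κ = dpart μ κ + 1 := by
  unfold dpart
  have hfin : {p | 0 < p ∧ (∃ i, μ i = p) ∧ ∀ j, κ j ≠ p}.Finite := by
    apply (Set.finite_Iic n).subset
    rintro p ⟨_, ⟨i, hi⟩, _⟩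
    have := Tf_le' hμ i
    simp only [Set.mem_Iic]
    omega
  rw [← Set.ncard_insert_of_notMem (a := n + 1) (hs := hfin)]
  · congr 1
    ext p
    simp only [Set.mem_ofPred_eq, Set.mem_insert_iff]
    constructor
    · rintro ⟨hp, ⟨i, hi⟩, hj⟩
      cases i with
      | zero => left; exact hi.symm
      | succ i => right; exact ⟨hp, ⟨i, hi⟩, hj⟩
    · rintro (rfl | ⟨hp, ⟨i, hi⟩, hj⟩)
      · exact ⟨by omega, ⟨0, rfl⟩, fun j => by have := Tf_le' hκ j; omega⟩
      · exact ⟨hp, ⟨i + 1, hi⟩, hj⟩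
  · rintro ⟨_, ⟨i, hi⟩, _⟩
    have := Tf_le' hμ i
    omega

lemma dpart_none_cons {n : ℕ} {μ κ : ℕ → ℕ} (hμ : μ ∈ Tf n) :
    dpart μ (pcons (n + 1) κ) = dpart μ κ := by
  unfold dpart
  congr 1
  ext p
  simp only [Set.mem_ofPred_eq]
  constructor
  · rintro ⟨hp, hi, hj⟩
    exact ⟨hp, hi, fun j => hj (j + 1)⟩
  · rintro ⟨hp, ⟨i, hi⟩, hj⟩
    refine ⟨hp, ⟨i, hi⟩, fun j => ?_⟩
    cases j with
    | zero => rw [pcons_zero]; have := Tf_le' hμ i; omega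
    | succ j => exact hj j

lemma dpart_cons_cons {n : ℕ} {μ κ : ℕ → ℕ} (hμ : μ ∈ Tf n) :
    dpart (pcons (n + 1) μ) (pcons (n + 1) κ) = dpart μ κ := by
  rw [← dpart_none_cons hμ]
  unfold dpart
  congr 1
  ext p
  simp only [Set.mem_ofPred_eq]
  constructor
  · rintro ⟨hp, ⟨i, hi⟩, hj⟩
    refine ⟨hp, ?_, hj⟩
    cases i with
    | zero => exact absurd hi (hj 0)
    | succ i => exact ⟨i, hi⟩
  · rintro ⟨hp, ⟨i, hi⟩, hj⟩
    exact ⟨hp, ⟨i + 1, hi⟩, hj⟩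

lemma Ilace_cons_cons {n : ℕ} {μ κ : ℕ → ℕ} (hμ : μ ∈ Tf n) :
    Ilace (pcons (n + 1) μ) (pcons (n + 1) κ) ↔ Ilace μ κ := by
  constructor
  · intro h i
    exact h (i + 1)
  · intro h i
    cases i with
    | zero => 
      have := Tf_le' hμ 0
      simp only [pcons_succ, pcons_zero]
      omega
    | succ i => exact h i

lemma Ilace_cons_none {n : ℕ} {μ κ : ℕ → ℕ} (hκ : κ ∈ Tf n) :
    Ilace (pcons (n + 1) μ) κ ↔ Ilace κ μ := by
  constructor
  · intro h i
    exact ⟨(h i).2, (h (i + 1)).1⟩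
  · intro h i
    cases i with
    | zero => 
      have := Tf_le' hκ 0
      simp only [pcons_succ, pcons_zero]
      exact ⟨by omega, (h 0).1⟩
    | succ i => exact ⟨(h i).2, (h (i + 1)).1⟩

lemma Ilace_none_cons {n : ℕ} {μ κ : ℕ → ℕ} (hμ : μ ∈ Tf n) :
    ¬ Ilace μ (pcons (n + 1) κ) := by
  intro h
  have h1 := (h 0).1
  have := Tf_le' hμ 0
  rw [pcons_zero] at h1
  omega

section ringA
variable {A : Type*} [CommRing A]

/-- Weight, state `0`. -/
def W0 (μ κ : ℕ → ℕ) (x : A) : A :=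
  if Ilace μ κ then 2 ^ dpart μ κ * x ^ (wt μ - wt κ) else 0

/-- Weight, state `1` (one unmatched larger part of `μ`). -/
def W1 (n : ℕ) (μ κ : ℕ → ℕ) (x : A) : A :=
  if Ilace κ μ then 2 ^ dpart μ κ * x ^ (n + wt μ - wt κ) else 0

lemma W0_11 {n : ℕ} {μ κ : ℕ → ℕ} (hμ : μ ∈ Tf n) (hκ : κ ∈ Tf n) (x : A) :
    W0 (pcons (n + 1) μ) (pcons (n + 1) κ) x = W0 μ κ x := by
  unfold W0
  rw [Ilace_cons_cons hμ, dpart_cons_cons hμ, wt_pcons hμ, wt_pcons hκ, Nat.add_sub_add_right]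

lemma W0_10 {n : ℕ} {μ κ : ℕ → ℕ} (hμ : μ ∈ Tf n) (hκ : κ ∈ Tf n) (x : A) :
    W0 (pcons (n + 1) μ) κ x = 2 * x * W1 n μ κ x := by
  unfold W0 W1
  rw [Ilace_cons_none hκ, dpart_cons_none hμ hκ, wt_pcons hμ]
  split_ifs with h
  · have := wt_le_add_of_Ilace hμ hκ h
    rw [show wt μ + (n + 1) - wt κ = (n + wt μ - wt κ) + 1 by omega]
    ring
  · simp

lemma W0_01 {n : ℕ} {μ κ : ℕ → ℕ} (hμ : μ ∈ Tf n) (hκ : κ ∈ Tf n) (x : A) :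
    W0 μ (pcons (n + 1) κ) x = 0 := by
  unfold W0
  rw [if_neg (Ilace_none_cons hμ)]

lemma W1_00 {n : ℕ} {μ κ : ℕ → ℕ} (hμ : μ ∈ Tf n) (hκ : κ ∈ Tf n) (x : A) :
    W1 (n + 1) μ κ x = x * W1 n μ κ x := by
  unfold W1
  split_ifs with h
  · have := wt_le_add_of_Ilace hμ hκ h
    rw [show n + 1 + wt μ - wt κ = (n + wt μ - wt κ) + 1 by omega]
    ring
  · simp

lemma W1_11 {n : ℕ} {μ κ : ℕ → ℕ} (hμ : μ ∈ Tf n) (hκ : κ ∈ Tf n) (x : A) :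
    W1 (n + 1) (pcons (n + 1) μ) (pcons (n + 1) κ) x = x * W1 n μ κ x := by
  unfold W1
  rw [Ilace_cons_cons hκ, dpart_cons_cons hμ, wt_pcons hμ, wt_pcons hκ]
  split_ifs with h
  · have := wt_le_add_of_Ilace hμ hκ h
    rw [show n + 1 + (wt μ + (n + 1)) - (wt κ + (n + 1)) = (n + wt μ - wt κ) + 1 by omega]
    ring
  · simp

lemma W1_01 {n : ℕ} {μ κ : ℕ → ℕ} (hμ : μ ∈ Tf n) (hκ : κ ∈ Tf n) (x : A) :
    W1 (n + 1) μ (pcons (n + 1) κ) x = W0 μ κ x := by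
  unfold W0 W1
  rw [Ilace_cons_none hμ, dpart_none_cons hμ, wt_pcons hκ,
    show n + 1 + wt μ - (wt κ + (n + 1)) = wt μ - wt κ by omega]

lemma W1_10 {n : ℕ} {μ κ : ℕ → ℕ} (hμ : μ ∈ Tf n) (hκ : κ ∈ Tf n) (x : A) :
    W1 (n + 1) (pcons (n + 1) μ) κ x = 0 := by
  unfold W1
  rw [if_neg (Ilace_none_cons hκ)]

lemma sum_Tf_succ (n : ℕ) (f : (ℕ → ℕ) → A) :
    ∑ κ ∈ Tf (n + 1), f κ = ∑ κ ∈ Tf n, f κ + ∑ κ ∈ Tf n, f (pcons (n + 1) κ) := by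
  rw [Tf, Finset.sum_union, Finset.sum_image (fun a _ b _ h => pcons_inj _ h)]
  rw [Finset.disjoint_left]
  intro κ h h'
  obtain ⟨κ', _, rfl⟩ := Finset.mem_image.1 h'
  have := Tf_le' h 0
  rw [pcons_zero] at this
  omega

def G00 (n : ℕ) (μ ν : ℕ → ℕ) (x y : A) : A := ∑ κ ∈ Tf n, W0 μ κ x * W0 κ ν y
def G01 (n : ℕ) (μ ν : ℕ → ℕ) (x y : A) : A := ∑ κ ∈ Tf n, W0 μ κ x * W1 n κ ν y
def G10 (n : ℕ) (μ ν : ℕ → ℕ) (x y : A) : A := ∑ κ ∈ Tf n, W1 n μ κ x * W0 κ ν y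
def G11 (n : ℕ) (μ ν : ℕ → ℕ) (x y : A) : A := ∑ κ ∈ Tf n, W1 n μ κ x * W1 n κ ν y

lemma G00_00 {n : ℕ} {μ ν : ℕ → ℕ} (hμ : μ ∈ Tf n) (hν : ν ∈ Tf n) (x y : A) :
    G00 (n + 1) μ ν x y = G00 n μ ν x y := by
  unfold G00
  rw [sum_Tf_succ]
  simp only [Finset.mul_sum, ← Finset.sum_add_distrib]
  apply Finset.sum_congr rfl
  intro κ hκ
  simp only [W0_11 hμ hκ, W0_10 hμ hκ, W0_01 hμ hκ, W1_00 hμ hκ, W1_11 hμ hκ, W1_01 hμ hκ, W1_10 hμ hκ,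
    W0_11 hκ hν, W0_10 hκ hν, W0_01 hκ hν, W1_00 hκ hν, W1_11 hκ hν, W1_01 hκ hν, W1_10 hκ hν]
  ring

lemma G00_01 {n : ℕ} {μ ν : ℕ → ℕ} (hμ : μ ∈ Tf n) (hν : ν ∈ Tf n) (x y : A) :
    G00 (n + 1) μ (pcons (n + 1) ν) x y = 0 := by
  unfold G00
  rw [sum_Tf_succ]
  simp only [Finset.mul_sum, ← Finset.sum_add_distrib]
  apply Finset.sum_eq_zero
  intro κ hκ
  simp only [W0_11 hμ hκ, W0_10 hμ hκ, W0_01 hμ hκ, W1_00 hμ hκ, W1_11 hμ hκ, W1_01 hμ hκ, W1_10 hμ hκ,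
    W0_11 hκ hν, W0_10 hκ hν, W0_01 hκ hν, W1_00 hκ hν, W1_11 hκ hν, W1_01 hκ hν, W1_10 hκ hν]
  ring

lemma G00_10 {n : ℕ} {μ ν : ℕ → ℕ} (hμ : μ ∈ Tf n) (hν : ν ∈ Tf n) (x y : A) :
    G00 (n + 1) (pcons (n + 1) μ) ν x y = 2 * x * G10 n μ ν x y + 2 * y * G01 n μ ν x y := by
  unfold G00 G01 G10
  rw [sum_Tf_succ]
  simp only [Finset.mul_sum, ← Finset.sum_add_distrib]
  apply Finset.sum_congr rfl
  intro κ hκ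
  simp only [W0_11 hμ hκ, W0_10 hμ hκ, W0_01 hμ hκ, W1_00 hμ hκ, W1_11 hμ hκ, W1_01 hμ hκ, W1_10 hμ hκ,
    W0_11 hκ hν, W0_10 hκ hν, W0_01 hκ hν, W1_00 hκ hν, W1_11 hκ hν, W1_01 hκ hν, W1_10 hκ hν]
  ring

lemma G00_11 {n : ℕ} {μ ν : ℕ → ℕ} (hμ : μ ∈ Tf n) (hν : ν ∈ Tf n) (x y : A) :
    G00 (n + 1) (pcons (n + 1) μ) (pcons (n + 1) ν) x y = G00 n μ ν x y := by
  unfold G00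
  rw [sum_Tf_succ]
  simp only [Finset.mul_sum, ← Finset.sum_add_distrib]
  apply Finset.sum_congr rfl
  intro κ hκ
  simp only [W0_11 hμ hκ, W0_10 hμ hκ, W0_01 hμ hκ, W1_00 hμ hκ, W1_11 hμ hκ, W1_01 hμ hκ, W1_10 hμ hκ,
    W0_11 hκ hν, W0_10 hκ hν, W0_01 hκ hν, W1_00 hκ hν, W1_11 hκ hν, W1_01 hκ hν, W1_10 hκ hν]
  ring

lemma G01_00 {n : ℕ} {μ ν : ℕ → ℕ} (hμ : μ ∈ Tf n) (hν : ν ∈ Tf n) (x y : A) :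
    G01 (n + 1) μ ν x y = y * G01 n μ ν x y := by
  unfold G01
  rw [sum_Tf_succ]
  simp only [Finset.mul_sum, ← Finset.sum_add_distrib]
  apply Finset.sum_congr rfl
  intro κ hκ
  simp only [W0_11 hμ hκ, W0_10 hμ hκ, W0_01 hμ hκ, W1_00 hμ hκ, W1_11 hμ hκ, W1_01 hμ hκ, W1_10 hμ hκ,
    W0_11 hκ hν, W0_10 hκ hν, W0_01 hκ hν, W1_00 hκ hν, W1_11 hκ hν, W1_01 hκ hν, W1_10 hκ hν]
  ring

lemma G01_01 {n : ℕ} {μ ν : ℕ → ℕ} (hμ : μ ∈ Tf n) (hν : ν ∈ Tf n) (x y : A) :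
    G01 (n + 1) μ (pcons (n + 1) ν) x y = G00 n μ ν x y := by
  unfold G00 G01
  rw [sum_Tf_succ]
  simp only [Finset.mul_sum, ← Finset.sum_add_distrib]
  apply Finset.sum_congr rfl
  intro κ hκ
  simp only [W0_11 hμ hκ, W0_10 hμ hκ, W0_01 hμ hκ, W1_00 hμ hκ, W1_11 hμ hκ, W1_01 hμ hκ, W1_10 hμ hκ,
    W0_11 hκ hν, W0_10 hκ hν, W0_01 hκ hν, W1_00 hκ hν, W1_11 hκ hν, W1_01 hκ hν, W1_10 hκ hν]
  ring

lemma G01_10 {n : ℕ} {μ ν : ℕ → ℕ} (hμ : μ ∈ Tf n) (hν : ν ∈ Tf n) (x y : A) :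
    G01 (n + 1) (pcons (n + 1) μ) ν x y = 2 * x * y * G11 n μ ν x y := by
  unfold G01 G11
  rw [sum_Tf_succ]
  simp only [Finset.mul_sum, ← Finset.sum_add_distrib]
  apply Finset.sum_congr rfl
  intro κ hκ
  simp only [W0_11 hμ hκ, W0_10 hμ hκ, W0_01 hμ hκ, W1_00 hμ hκ, W1_11 hμ hκ, W1_01 hμ hκ, W1_10 hμ hκ,
    W0_11 hκ hν, W0_10 hκ hν, W0_01 hκ hν, W1_00 hκ hν, W1_11 hκ hν, W1_01 hκ hν, W1_10 hκ hν]
  ring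

lemma G01_11 {n : ℕ} {μ ν : ℕ → ℕ} (hμ : μ ∈ Tf n) (hν : ν ∈ Tf n) (x y : A) :
    G01 (n + 1) (pcons (n + 1) μ) (pcons (n + 1) ν) x y = 2 * x * G10 n μ ν x y + y * G01 n μ ν x y := by
  unfold G01 G10
  rw [sum_Tf_succ]
  simp only [Finset.mul_sum, ← Finset.sum_add_distrib]
  apply Finset.sum_congr rfl
  intro κ hκ
  simp only [W0_11 hμ hκ, W0_10 hμ hκ, W0_01 hμ hκ, W1_00 hμ hκ, W1_11 hμ hκ, W1_01 hμ hκ, W1_10 hμ hκ,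
    W0_11 hκ hν, W0_10 hκ hν, W0_01 hκ hν, W1_00 hκ hν, W1_11 hκ hν, W1_01 hκ hν, W1_10 hκ hν]
  ring

lemma G10_00 {n : ℕ} {μ ν : ℕ → ℕ} (hμ : μ ∈ Tf n) (hν : ν ∈ Tf n) (x y : A) :
    G10 (n + 1) μ ν x y = x * G10 n μ ν x y + 2 * y * G01 n μ ν x y := by
  unfold G01 G10
  rw [sum_Tf_succ]
  simp only [Finset.mul_sum, ← Finset.sum_add_distrib]
  apply Finset.sum_congr rfl
  intro κ hκ
  simp only [W0_11 hμ hκ, W0_10 hμ hκ, W0_01 hμ hκ, W1_00 hμ hκ, W1_11 hμ hκ, W1_01 hμ hκ, W1_10 hμ hκ,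
    W0_11 hκ hν, W0_10 hκ hν, W0_01 hκ hν, W1_00 hκ hν, W1_11 hκ hν, W1_01 hκ hν, W1_10 hκ hν]
  ring

lemma G10_01 {n : ℕ} {μ ν : ℕ → ℕ} (hμ : μ ∈ Tf n) (hν : ν ∈ Tf n) (x y : A) :
    G10 (n + 1) μ (pcons (n + 1) ν) x y = G00 n μ ν x y := by
  unfold G00 G10
  rw [sum_Tf_succ]
  simp only [Finset.mul_sum, ← Finset.sum_add_distrib]
  apply Finset.sum_congr rfl
  intro κ hκ
  simp only [W0_11 hμ hκ, W0_10 hμ hκ, W0_01 hμ hκ, W1_00 hμ hκ, W1_11 hμ hκ, W1_01 hμ hκ, W1_10 hμ hκ,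
    W0_11 hκ hν, W0_10 hκ hν, W0_01 hκ hν, W1_00 hκ hν, W1_11 hκ hν, W1_01 hκ hν, W1_10 hκ hν]
  ring

lemma G10_10 {n : ℕ} {μ ν : ℕ → ℕ} (hμ : μ ∈ Tf n) (hν : ν ∈ Tf n) (x y : A) :
    G10 (n + 1) (pcons (n + 1) μ) ν x y = 2 * x * y * G11 n μ ν x y := by
  unfold G10 G11
  rw [sum_Tf_succ]
  simp only [Finset.mul_sum, ← Finset.sum_add_distrib]
  apply Finset.sum_congr rfl
  intro κ hκ
  simp only [W0_11 hμ hκ, W0_10 hμ hκ, W0_01 hμ hκ, W1_00 hμ hκ, W1_11 hμ hκ, W1_01 hμ hκ, W1_10 hμ hκ,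
    W0_11 hκ hν, W0_10 hκ hν, W0_01 hκ hν, W1_00 hκ hν, W1_11 hκ hν, W1_01 hκ hν, W1_10 hκ hν]
  ring

lemma G10_11 {n : ℕ} {μ ν : ℕ → ℕ} (hμ : μ ∈ Tf n) (hν : ν ∈ Tf n) (x y : A) :
    G10 (n + 1) (pcons (n + 1) μ) (pcons (n + 1) ν) x y = x * G10 n μ ν x y := by
  unfold G10
  rw [sum_Tf_succ]
  simp only [Finset.mul_sum, ← Finset.sum_add_distrib]
  apply Finset.sum_congr rfl
  intro κ hκ
  simp only [W0_11 hμ hκ, W0_10 hμ hκ, W0_01 hμ hκ, W1_00 hμ hκ, W1_11 hμ hκ, W1_01 hμ hκ, W1_10 hμ hκ,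
    W0_11 hκ hν, W0_10 hκ hν, W0_01 hκ hν, W1_00 hκ hν, W1_11 hκ hν, W1_01 hκ hν, W1_10 hκ hν]
  ring

lemma G11_00 {n : ℕ} {μ ν : ℕ → ℕ} (hμ : μ ∈ Tf n) (hν : ν ∈ Tf n) (x y : A) :
    G11 (n + 1) μ ν x y = x * y * G11 n μ ν x y := by
  unfold G11
  rw [sum_Tf_succ]
  simp only [Finset.mul_sum, ← Finset.sum_add_distrib]
  apply Finset.sum_congr rfl
  intro κ hκ
  simp only [W0_11 hμ hκ, W0_10 hμ hκ, W0_01 hμ hκ, W1_00 hμ hκ, W1_11 hμ hκ, W1_01 hμ hκ, W1_10 hμ hκ,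
    W0_11 hκ hν, W0_10 hκ hν, W0_01 hκ hν, W1_00 hκ hν, W1_11 hκ hν, W1_01 hκ hν, W1_10 hκ hν]
  ring

lemma G11_01 {n : ℕ} {μ ν : ℕ → ℕ} (hμ : μ ∈ Tf n) (hν : ν ∈ Tf n) (x y : A) :
    G11 (n + 1) μ (pcons (n + 1) ν) x y = x * G10 n μ ν x y + y * G01 n μ ν x y := by
  unfold G01 G10 G11
  rw [sum_Tf_succ]
  simp only [Finset.mul_sum, ← Finset.sum_add_distrib]
  apply Finset.sum_congr rfl
  intro κ hκ
  simp only [W0_11 hμ hκ, W0_10 hμ hκ, W0_01 hμ hκ, W1_00 hμ hκ, W1_11 hμ hκ, W1_01 hμ hκ, W1_10 hμ hκ,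
    W0_11 hκ hν, W0_10 hκ hν, W0_01 hκ hν, W1_00 hκ hν, W1_11 hκ hν, W1_01 hκ hν, W1_10 hκ hν]
  ring

lemma G11_10 {n : ℕ} {μ ν : ℕ → ℕ} (hμ : μ ∈ Tf n) (hν : ν ∈ Tf n) (x y : A) :
    G11 (n + 1) (pcons (n + 1) μ) ν x y = 0 := by
  unfold G11
  rw [sum_Tf_succ]
  simp only [Finset.mul_sum, ← Finset.sum_add_distrib]
  apply Finset.sum_eq_zero
  intro κ hκ
  simp only [W0_11 hμ hκ, W0_10 hμ hκ, W0_01 hμ hκ, W1_00 hμ hκ, W1_11 hμ hκ, W1_01 hμ hκ, W1_10 hμ hκ,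
    W0_11 hκ hν, W0_10 hκ hν, W0_01 hκ hν, W1_00 hκ hν, W1_11 hκ hν, W1_01 hκ hν, W1_10 hκ hν]
  ring

lemma G11_11 {n : ℕ} {μ ν : ℕ → ℕ} (hμ : μ ∈ Tf n) (hν : ν ∈ Tf n) (x y : A) :
    G11 (n + 1) (pcons (n + 1) μ) (pcons (n + 1) ν) x y = x * y * G11 n μ ν x y := by
  unfold G11
  rw [sum_Tf_succ]
  simp only [Finset.mul_sum, ← Finset.sum_add_distrib]
  apply Finset.sum_congr rfl
  intro κ hκ
  simp only [W0_11 hμ hκ, W0_10 hμ hκ, W0_01 hμ hκ, W1_00 hμ hκ, W1_11 hμ hκ, W1_01 hμ hκ, W1_10 hμ hκ,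
    W0_11 hκ hν, W0_10 hκ hν, W0_01 hκ hν, W1_00 hκ hν, W1_11 hκ hν, W1_01 hκ hν, W1_10 hκ hν]
  ring


lemma key (n : ℕ) : ∀ μ ∈ Tf n, ∀ ν ∈ Tf n, ∀ x y : A,
    (x + y) * G00 n μ ν y x = (x + y) * G00 n μ ν x y ∧
    (x + y) * G11 n μ ν y x = (x + y) * G11 n μ ν x y ∧
    (x + y) * G01 n μ ν y x = 2 * y * G01 n μ ν x y + (x - y) * G10 n μ ν x y ∧
    (x + y) * G10 n μ ν y x = (y - x) * G01 n μ ν x y + 2 * x * G10 n μ ν x y := by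
  induction n with
  | zero =>
    intro μ hμ ν hν x y
    simp only [Tf, Finset.mem_singleton] at hμ hν
    subst hμ hν
    have h0 : ∀ z : A, W0 (fun _ => 0) (fun _ => 0) z = 1 := by
      intro z
      simp [W0, Ilace, dpart]
    have h1 : ∀ z : A, W1 0 (fun _ => 0) (fun _ => 0) z = 1 := by
      intro z
      simp [W1, Ilace, dpart]
    simp only [G00, G01, G10, G11, Tf, Finset.sum_singleton, h0, h1]
    refine ⟨trivial, trivial, ?_, ?_⟩ <;> ring
  | succ n ih =>
    intro μ hμ ν hν x y
    simp only [Tf, Finset.mem_union, Finset.mem_image] at hμ hν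
    rcases hμ with hμ | ⟨μ, hμ, rfl⟩ <;> rcases hν with hν | ⟨ν, hν, rfl⟩ <;>
      obtain ⟨e00, e11, e01, e10⟩ := ih μ hμ ν hν x y
    · rw [G00_00 hμ hν x y, G00_00 hμ hν y x, G01_00 hμ hν x y, G01_00 hμ hν y x, G10_00 hμ hν x y, G10_00 hμ hν y x, G11_00 hμ hν x y, G11_00 hμ hν y x]
      refine ⟨?_, ?_, ?_, ?_⟩
      · linear_combination e00
      · linear_combination x * y * e11
      · linear_combination x * e01
      · linear_combination y * e10 + 2 * x * e01
    · rw [G00_01 hμ hν x y, G00_01 hμ hν y x, G01_01 hμ hν x y, G01_01 hμ hν y x, G10_01 hμ hν x y, G10_01 hμ hν y x, G11_01 hμ hν x y, G11_01 hμ hν y x]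
      refine ⟨?_, ?_, ?_, ?_⟩
      · ring
      · linear_combination y * e10 + x * e01
      · linear_combination e00
      · linear_combination e00
    · rw [G00_10 hμ hν x y, G00_10 hμ hν y x, G01_10 hμ hν x y, G01_10 hμ hν y x, G10_10 hμ hν x y, G10_10 hμ hν y x, G11_10 hμ hν x y, G11_10 hμ hν y x]
      refine ⟨?_, ?_, ?_, ?_⟩
      · linear_combination 2 * y * e10 + 2 * x * e01
      · ring
      · linear_combination 2 * x * y * e11
      · linear_combination 2 * x * y * e11
    · rw [G00_11 hμ hν x y, G00_11 hμ hν y x, G01_11 hμ hν x y, G01_11 hμ hν y x, G10_11 hμ hν x y, G10_11 hμ hν y x, G11_11 hμ hν x y, G11_11 hμ hν y x]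
      refine ⟨?_, ?_, ?_, ?_⟩
      · linear_combination e00
      · linear_combination x * y * e11
      · linear_combination 2 * y * e10 + x * e01
      · linear_combination y * e10

lemma W0_map {B : Type*} [CommRing B] (f : A →+* B) (μ κ : ℕ → ℕ) (x : A) :
    f (W0 μ κ x) = W0 μ κ (f x) := by
  unfold W0
  have h2 : f 2 = 2 := map_ofNat f 2
  split_ifs <;> simp [h2]

end ringA

lemma G00_symm (n : ℕ) (μ ν : ℕ → ℕ) (hμ : μ ∈ Tf n) (hν : ν ∈ Tf n) (x y : ℚ) :
    G00 n μ ν y x = G00 n μ ν x y := by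
  have h := (key n μ hμ ν hν (Polynomial.C x) (Polynomial.X : Polynomial ℚ)).1
  have hne : (Polynomial.C x + Polynomial.X : Polynomial ℚ) ≠ 0 := by
    rw [add_comm]
    exact Polynomial.X_add_C_ne_zero x
  have h2 := congrArg (Polynomial.evalRingHom y) (mul_left_cancel₀ hne h)
  simpa [G00, map_sum, map_mul, W0_map] using h2

lemma Tf_mono {n : ℕ} {μ κ : ℕ → ℕ} (hμ : μ ∈ Tf n) (hκ : IsSP κ) (h : Ilace μ κ) :
    κ ∈ Tf n :=
  (mem_Tf n κ).2 ⟨hκ, (h 0).1.trans (Tf_le' hμ 0)⟩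

lemma chain_set (μ : ℕ → ℕ) (n N : ℕ) (hμ : μ ∈ Tf n) :
    {κ | IsChain μ (N + 1) κ} =
      ⋃ κ ∈ ((Tf n).filter (fun κ => Ilace μ κ) : Set (ℕ → ℕ)),
        (fun c : Fin (N + 1) → ℕ → ℕ => (Fin.cons μ c : Fin (N + 2) → ℕ → ℕ)) ''
          {c | IsChain κ N c} := by
  ext c
  simp only [Set.mem_ofPred_eq, Set.mem_iUnion, Set.mem_image, Finset.coe_filter, exists_prop]
  constructor
  · rintro ⟨h1, h2, h3, h4⟩
    have h40 := h4 0
    simp only [Fin.castSucc_zero, h2] at h40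
    refine ⟨c (Fin.succ 0), ⟨Tf_mono hμ (h1 _) h40, h40⟩, Fin.tail c, ⟨?_, rfl, ?_, ?_⟩, ?_⟩
    · exact fun i => h1 _
    · rw [← h3]; rfl
    · intro i
      exact h4 i.succ
    · rw [← h2]
      exact Fin.cons_self_tail c
  · rintro ⟨κ, ⟨hκ, hl⟩, c, ⟨h1, h2, h3, h4⟩, rfl⟩
    refine ⟨?_, rfl, ?_, ?_⟩
    · intro i
      cases i using Fin.cases with
      | zero => exact ((mem_Tf n μ).1 hμ).1
      | succ i => exact h1 i
    · exact h3
    · intro i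
      cases i using Fin.cases with
      | zero => 
        simp only [Fin.castSucc_zero, Fin.cons_zero, Fin.cons_succ, h2]
        exact hl
      | succ i => exact h4 i

lemma chain_finite (N : ℕ) : ∀ (μ : ℕ → ℕ), IsSP μ → {κ | IsChain μ N κ}.Finite := by
  induction N with
  | zero =>
    intro μ _
    apply (Set.finite_singleton (fun _ => μ)).subset
    rintro κ ⟨_, h, _⟩
    simp only [Set.mem_singleton_iff]
    funext i
    obtain rfl : i = 0 := Fin.ext (by omega)
    exact h
  | succ N ih =>
    intro μ hμ
    have hm : μ ∈ Tf (μ 0) := (mem_Tf _ _).2 ⟨hμ, le_rfl⟩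
    rw [chain_set μ (μ 0) N hm]
    apply Set.Finite.biUnion (Finset.finite_toSet _)
    intro κ hκ
    apply Set.Finite.image
    apply ih
    simp only [Finset.coe_filter, Set.mem_ofPred_eq] at hκ
    exact ((mem_Tf _ _).1 hκ.1).1

lemma F_succ (μ : ℕ → ℕ) (n N : ℕ) (hμ : μ ∈ Tf n) (x : Fin (N + 1) → ℚ) :
    F μ (N + 1) x = ∑ κ ∈ Tf n, W0 μ κ (x 0) * F κ N (fun i => x i.succ) := by
  change ∑ᶠ κ ∈ {κ | IsChain μ (N + 1) κ}, cw (N + 1) x κ = _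
  rw [chain_set μ n N hμ, finsum_mem_biUnion]
  · rw [finsum_mem_coe_finset, Finset.sum_filter]
    apply Finset.sum_congr rfl
    intro κ hκ
    unfold W0
    split_ifs with h
    · rw [finsum_mem_image]
      · change _ = _ * ∑ᶠ c ∈ {c | IsChain κ N c}, cw N _ c
        rw [mul_finsum_mem' _ _ (chain_finite N κ ((mem_Tf _ _).1 hκ).1)]
        apply finsum_mem_congr rfl
        rintro c ⟨_, h2, _⟩
        rw [cw, Fin.prod_univ_succ]
        simp only [Fin.castSucc_zero, Fin.cons_zero, Fin.cons_succ, h2]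
        rfl
      · intro a _ b _ hab
        exact (Fin.cons_right_injective (α := fun _ => ℕ → ℕ) μ) hab
    · simp
  · intro a _ b _ hab
    rw [Function.onFun, Set.disjoint_left]
    rintro _ ⟨c, hc, rfl⟩ ⟨c', hc', h⟩
    apply hab
    have := (Fin.cons_right_injective (α := fun _ => ℕ → ℕ) μ) h
    rw [← hc.2.1, ← hc'.2.1, this]
  · exact Finset.finite_toSet _
  · intro κ hκ
    apply Set.Finite.image
    apply chain_finite
    simp only [Finset.coe_filter, Set.mem_ofPred_eq] at hκ
    exact ((mem_Tf _ _).1 hκ.1).1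

lemma F_two (μ : ℕ → ℕ) (n N : ℕ) (hμ : μ ∈ Tf n) (x : Fin (N + 2) → ℚ) :
    F μ (N + 2) x = ∑ ν ∈ Tf n, G00 n μ ν (x 0) (x 1) * F ν N (fun i => x i.succ.succ) := by
  rw [F_succ μ n (N + 1) hμ]
  calc _ = ∑ κ ∈ Tf n, ∑ ν ∈ Tf n,
      W0 μ κ (x 0) * (W0 κ ν (x 1) * F ν N (fun i => x i.succ.succ)) := by
        apply Finset.sum_congr rfl
        intro κ hκ
        rw [F_succ κ n N hκ, Finset.mul_sum]
        rfl
    _ = _ := by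
        rw [Finset.sum_comm]
        apply Finset.sum_congr rfl
        intro ν _
        rw [G00, Finset.sum_mul]
        apply Finset.sum_congr rfl
        intro κ _
        ring

lemma F_swap (N : ℕ) : ∀ (i : Fin N) (μ : ℕ → ℕ), IsSP μ → ∀ x : Fin (N + 1) → ℚ,
    F μ (N + 1) (fun j => x (Equiv.swap i.castSucc i.succ j)) = F μ (N + 1) x := by
  induction N with
  | zero => exact fun i => i.elim0
  | succ N ih =>
    intro i μ hμ x
    have hm : μ ∈ Tf (μ 0) := (mem_Tf _ _).2 ⟨hμ, le_rfl⟩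
    cases i using Fin.cases with
    | zero =>
      rw [F_two μ _ N hm, F_two μ _ N hm]
      apply Finset.sum_congr rfl
      intro ν hν
      have a0 : Equiv.swap (Fin.castSucc (0 : Fin (N + 1))) (Fin.succ 0) 0 = 1 :=
        Equiv.swap_apply_left _ _
      have a1 : Equiv.swap (Fin.castSucc (0 : Fin (N + 1))) (Fin.succ 0) 1 = 0 :=
        Equiv.swap_apply_right _ _
      have a2 : ∀ j : Fin N,
          Equiv.swap (Fin.castSucc (0 : Fin (N + 1))) (Fin.succ 0) j.succ.succ = j.succ.succ := by
        intro j
        apply Equiv.swap_apply_of_ne_of_ne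
        · exact Fin.succ_ne_zero _
        · intro h
          exact Fin.succ_ne_zero _ (Fin.succ_injective _ h)
      simp only [a0, a1, a2]
      rw [G00_symm _ _ _ hm hν]
    | succ i =>
      rw [F_succ μ _ _ hm, F_succ μ _ _ hm]
      apply Finset.sum_congr rfl
      intro κ hκ
      have a0 : Equiv.swap i.succ.castSucc i.succ.succ 0 = 0 := by
        apply Equiv.swap_apply_of_ne_of_ne
        · exact (Fin.succ_ne_zero i.castSucc).symm
        · exact (Fin.succ_ne_zero _).symm
      have a1 : ∀ j : Fin (N + 1), Equiv.swap i.succ.castSucc i.succ.succ j.succ =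
          (Equiv.swap i.castSucc i.succ j).succ := by
        intro j
        rw [← Fin.succ_castSucc]
        exact (Function.Injective.map_swap (Fin.succ_injective _) _ _ _).symm
      simp only [a0, a1]
      rw [ih i κ ((mem_Tf _ _).1 hκ).1 (fun j => x j.succ)]

/-- `F_μ(x₁,…,x_N)` is a symmetric polynomial: for every permutation `σ` of the
variables, `F_μ(x_{σ(1)},…,x_{σ(N)}) = F_μ(x₁,…,x_N)` (as functions on `ℚ`, which over
the infinite field `ℚ` is equivalent to the polynomial identity). -/
theorem stmt6 (μ : ℕ → ℕ) (hμ : IsSP μ) (N : ℕ) (hN : 0 < N)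
    (σ : Equiv.Perm (Fin N)) (x : Fin N → ℚ) :
    F μ N (fun i => x (σ i)) = F μ N x := by
  obtain ⟨N, rfl⟩ : ∃ M, N = M + 1 := ⟨N - 1, by omega⟩
  have hσ : σ ∈ Submonoid.closure
      (Set.range fun i : Fin N => Equiv.swap i.castSucc i.succ) := by
    rw [Equiv.Perm.mclosure_swap_castSucc_succ]
    trivial
  induction hσ using Submonoid.closure_induction generalizing x with
  | mem τ h =>
    obtain ⟨i, rfl⟩ := h
    exact F_swap N i μ hμ x
  | one => rfl
  | mul a b _ _ ha hb =>
    have h1 := hb (fun i => x (a i))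
    exact h1.trans (ha x)

end PaperIB
end
end

section
/- For any two strict partitions μ and ν, the two-variable polynomial G(x,y) = ∑_{κ} 2^{#(μ|κ) + #(κ|ν)} · x^{|μ|−|κ|} · y^{|κ|−|ν|}, where the sum runs over all strict partitions κ with μ ≻ κ and κ ≻ ν, is symmetric in x and y: G(x,y) = G(y,x). -/
open scoped Classical

noncomputable section

namespace PaperIB

/-- Site weight: `1` at `0`, `x` at `1`, and `0` elsewhere. -/
def gw (x : ℚ) (e : ℤ) : ℚ := if e = 0 then 1 else if e = 1 then x else 0

def ind (S : Finset ℕ) (p : ℕ) : ℤ := if p ∈ S then 1 else 0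

def cn (S : Finset ℕ) (b p : ℕ) : ℤ := ∑ q ∈ Finset.Icc p b, ind S q

def uw (A B : Finset ℕ) (p : ℕ) : ℚ := if p ∈ A ∧ p ∉ B then 2 else 1

/-- Weight of a configuration `K` on the sites `1..b` with incoming state `(d, e)`. -/
def trm (x y : ℚ) (M N K : Finset ℕ) (b : ℕ) (d e : ℤ) : ℚ :=
  ∏ p ∈ Finset.Icc 1 b, (uw M K p * uw K N p * gw x (d + cn M b p - cn K b p) *
    gw y (e + cn K b p - cn N b p))

def Tr (x y : ℚ) (M N : Finset ℕ) (b : ℕ) (d e : ℤ) : ℚ :=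
  ∑ K ∈ (Finset.Icc 1 b).powerset, trm x y M N K b d e

lemma cn_succ (S : Finset ℕ) (b p : ℕ) (h : p ≤ b + 1) :
    cn S (b + 1) p = cn S b p + ind S (b + 1) := by
  unfold cn
  rw [Finset.sum_Icc_succ_top h]

lemma cn_insert (K : Finset ℕ) (b p : ℕ) : cn (insert (b + 1) K) b p = cn K b p := by
  unfold cn
  refine Finset.sum_congr rfl fun q hq => ?_
  have : q ≠ b + 1 := by have := (Finset.mem_Icc.mp hq).2; omega
  simp [ind, this]

lemma cn_top (S : Finset ℕ) (b : ℕ) : cn S b (b + 1) = 0 := by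
  simp [cn]

lemma trm_insert (x y : ℚ) (M N K : Finset ℕ) (b : ℕ) (d e : ℤ) :
    trm x y M N (insert (b + 1) K) b d e = trm x y M N K b d e := by
  unfold trm
  refine Finset.prod_congr rfl fun q hq => ?_
  have : q ≠ b + 1 := by have := (Finset.mem_Icc.mp hq).2; omega
  rw [cn_insert]
  simp [uw, this]

lemma trm_succ (x y : ℚ) (M N K : Finset ℕ) (b : ℕ) (d e : ℤ) :
    trm x y M N K (b + 1) d e =
      uw M K (b + 1) * uw K N (b + 1) * gw x (d + ind M (b + 1) - ind K (b + 1)) *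
        gw y (e + ind K (b + 1) - ind N (b + 1)) *
        trm x y M N K b (d + ind M (b + 1) - ind K (b + 1))
          (e + ind K (b + 1) - ind N (b + 1)) := by
  conv_lhs => unfold trm
  rw [Finset.prod_Icc_succ_top (by omega), mul_comm]
  congr 1
  · rw [cn_succ _ _ _ le_rfl, cn_succ _ _ _ le_rfl, cn_succ _ _ _ le_rfl, cn_top, cn_top, cn_top]
    simp
  · unfold trm
    refine Finset.prod_congr rfl fun q hq => ?_
    have : q ≤ b + 1 := by have := (Finset.mem_Icc.mp hq).2; omega
    rw [cn_succ _ _ _ this, cn_succ _ _ _ this, cn_succ _ _ _ this]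
    congr 2
    · congr 1
      ring_nf
    · ring

lemma Tr_succ (x y : ℚ) (M N : Finset ℕ) (b : ℕ) (d e : ℤ) :
    Tr x y M N (b + 1) d e =
      (if b + 1 ∈ M then 2 else 1) * gw x (d + ind M (b + 1)) * gw y (e - ind N (b + 1)) *
        Tr x y M N b (d + ind M (b + 1)) (e - ind N (b + 1)) +
      (if b + 1 ∈ N then 1 else 2) * gw x (d + ind M (b + 1) - 1) *
        gw y (e + 1 - ind N (b + 1)) *
        Tr x y M N b (d + ind M (b + 1) - 1) (e + 1 - ind N (b + 1)) := by
  have h1 : Finset.Icc 1 (b + 1) = insert (b + 1) (Finset.Icc 1 b) := by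
    ext q; simp; omega
  have h2 : b + 1 ∉ Finset.Icc 1 b := by simp
  conv_lhs => unfold Tr
  rw [h1, Finset.sum_powerset_insert h2]
  congr 1
  · unfold Tr
    rw [Finset.mul_sum]
    refine Finset.sum_congr rfl fun K hK => ?_
    have hK' : b + 1 ∉ K := fun h => h2 (Finset.mem_powerset.mp hK h)
    have h0 : ind K (b + 1) = 0 := by simp [ind, hK']
    rw [trm_succ, h0]
    simp [uw, hK']
  · unfold Tr
    rw [Finset.mul_sum]
    refine Finset.sum_congr rfl fun K hK => ?_
    have h0 : ind (insert (b + 1) K) (b + 1) = 1 := by simp [ind]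
    rw [trm_succ, h0, trm_insert]
    simp [uw]

lemma Tr_inv (x y : ℚ) (M N : Finset ℕ) (b : ℕ) :
    Tr x y M N b 0 0 = Tr y x M N b 0 0 ∧ Tr x y M N b 1 1 = Tr y x M N b 1 1 ∧
    Tr x y M N b 1 0 - Tr x y M N b 0 1 = Tr y x M N b 1 0 - Tr y x M N b 0 1 ∧
    (x + y) * (Tr x y M N b 0 1 - Tr y x M N b 0 1) +
      (x - y) * (Tr x y M N b 1 0 - Tr x y M N b 0 1) = 0 := by
  induction b with
  | zero => simp [Tr, trm]
  | succ b ih =>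
    obtain ⟨i1, i2, i3, i4⟩ := ih
    simp only [Tr_succ]
    by_cases hM : b + 1 ∈ M <;> by_cases hN : b + 1 ∈ N <;> simp [ind, hM, hN, gw]
    · refine ⟨i1, ?_, ?_, ?_⟩
      · linear_combination x * y * i2
      · linear_combination -i4 - y * i3
      · linear_combination (x + 2 * y) * i4 + 2 * y * (x + y) * i3
    · refine ⟨?_, Or.inr ?_⟩
      · linear_combination 2 * i4 + 2 * y * i3
      · linear_combination 2 * x * y * i2
    · refine ⟨?_, Or.inr ?_⟩
      · linear_combination i4 + y * i3
      · linear_combination i1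
    · refine ⟨i1, ?_, ?_, ?_⟩
      · linear_combination x * y * i2
      · linear_combination i4 + y * i3
      · linear_combination x * i4

/-- The finite set of parts. -/
def prt (B : ℕ) (κ : ℕ → ℕ) : Finset ℕ := (Finset.Icc 1 B).filter fun p => ∃ i, κ i = p

lemma IsSP.anti {κ : ℕ → ℕ} (h : IsSP κ) : Antitone κ := by
  refine antitone_nat_of_succ_le fun i => ?_
  rcases Nat.eq_zero_or_pos (κ i) with h0 | h0
  · rw [h.2 i h0]; omega
  · exact (h.1 i h0).le

lemma IsSP.lt {κ : ℕ → ℕ} (h : IsSP κ) {i j : ℕ} (hij : i < j) (hj : 0 < κ j) : κ j < κ i := by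
  have h1 : κ j ≤ κ (i + 1) := h.anti hij
  have h2 : κ (i + 1) ≤ κ i := h.anti (Nat.le_succ i)
  have := h.1 i (by omega)
  omega

lemma IsSP.bd {κ : ℕ → ℕ} (h : IsSP κ) (i : ℕ) : κ i = 0 ∨ κ i + i ≤ κ 0 := by
  induction i with
  | zero => right; omega
  | succ i ih =>
    rcases Nat.eq_zero_or_pos (κ i) with h0 | h0
    · left; exact h.2 i h0
    · have := h.1 i h0
      omega

lemma cn_spec {κ : ℕ → ℕ} (h : IsSP κ) {B : ℕ} (hB : κ 0 ≤ B) {p : ℕ} (hp : 1 ≤ p) :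
    ∃ n : ℕ, cn (prt B κ) B p = n ∧ n ≤ B ∧ ∀ i, p ≤ κ i ↔ i < n := by
  have hex : ∃ i, κ i < p := ⟨B, by rcases h.bd B with h | h <;> omega⟩
  have hspec : ∀ i, p ≤ κ i ↔ i < Nat.find hex := by
    intro i
    constructor
    · intro hi
      by_contra hc
      have h1 := h.anti (not_lt.mp hc)
      have h2 := Nat.find_spec hex
      omega
    · intro hi
      exact not_lt.mp (Nat.find_min hex hi)
  refine ⟨Nat.find hex, ?_, ?_, hspec⟩
  · have h1 : (Finset.Icc p B).filter (fun q => q ∈ prt B κ) =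
        (Finset.range (Nat.find hex)).image κ := by
      ext q
      simp only [Finset.mem_filter, prt, Finset.mem_Icc, Finset.mem_image, Finset.mem_range]
      constructor
      · rintro ⟨⟨h1, -⟩, -, i, rfl⟩
        exact ⟨i, (hspec i).1 h1, rfl⟩
      · rintro ⟨i, hi, rfl⟩
        have h1 := (hspec i).2 hi
        have h2 := h.anti (Nat.zero_le i)
        exact ⟨⟨h1, by omega⟩, ⟨by omega, by omega⟩, i, rfl⟩
    have h2 : cn (prt B κ) B p = (((Finset.Icc p B).filter (fun q => q ∈ prt B κ)).card : ℤ) := by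
      simp only [cn, ind, Finset.sum_boole]
    rw [h2, h1, Finset.card_image_of_injOn, Finset.card_range]
    intro i hi j hj hij
    have hi' := (hspec i).2 (by simpa using hi)
    have hj' := (hspec j).2 (by simpa using hj)
    rcases lt_trichotomy i j with hlt | hlt | hlt
    · have := h.lt hlt (by omega)
      omega
    · exact hlt
    · have := h.lt hlt (by omega)
      omega
  · refine Nat.find_min' hex ?_
    rcases h.bd B with h | h <;> omega

lemma wt_eq_s7 {κ : ℕ → ℕ} (h : IsSP κ) {B : ℕ} (hB : κ 0 ≤ B) :
    (wt κ : ℤ) = ∑ p ∈ Finset.Icc 1 B, cn (prt B κ) B p := by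
  have h1 : wt κ = ∑ i ∈ Finset.range B, κ i := by
    unfold wt
    refine finsum_eq_sum_of_support_subset _ ?_
    intro i hi
    have hi' : κ i ≠ 0 := hi
    have := h.bd i
    simp
    omega
  have h2 : ∀ i, κ i = ∑ p ∈ Finset.Icc 1 B, if p ≤ κ i then 1 else 0 := by
    intro i
    have h3 : (Finset.Icc 1 B).filter (fun p => p ≤ κ i) = Finset.Icc 1 (κ i) := by
      ext q
      have := h.anti (Nat.zero_le i)
      simp
      omega
    rw [← Finset.sum_filter, h3]
    simp
  rw [h1, Finset.sum_congr rfl fun i _ => h2 i, Finset.sum_comm]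
  push_cast
  refine Finset.sum_congr rfl fun p hp => ?_
  obtain ⟨n, hn, hnB, hs⟩ := cn_spec h hB (Finset.mem_Icc.mp hp).1
  rw [hn]
  simp only [hs]
  have h4 : (Finset.range B).filter (fun i => i < n) = Finset.range n := by
    ext q; simp; omega
  rw [← Finset.sum_filter, h4]
  simp

lemma dpart_eq {μ κ : ℕ → ℕ} (h : IsSP μ) {B : ℕ} (hB : μ 0 ≤ B) :
    ∏ p ∈ Finset.Icc 1 B, uw (prt B μ) (prt B κ) p = 2 ^ dpart μ κ := by
  have h1 : {p | 0 < p ∧ (∃ i, μ i = p) ∧ ∀ j, κ j ≠ p} =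
      (((Finset.Icc 1 B).filter fun p => p ∈ prt B μ ∧ p ∉ prt B κ : Finset ℕ) : Set ℕ) := by
    ext p
    simp only [Set.mem_ofPred_eq, prt, Finset.coe_filter, Finset.mem_filter, Finset.mem_Icc]
    constructor
    · rintro ⟨h1, ⟨i, rfl⟩, h2⟩
      have := h.anti (Nat.zero_le i)
      exact ⟨⟨h1, by omega⟩, ⟨⟨h1, by omega⟩, i, rfl⟩, fun hh => by
        obtain ⟨j, hj⟩ := hh.2
        exact h2 j hj⟩
    · rintro ⟨h1, ⟨-, h2⟩, h3⟩
      exact ⟨h1.1, h2, fun j hj => h3 ⟨h1, j, hj⟩⟩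
  unfold dpart
  rw [h1, Set.ncard_coe_finset]
  simp only [uw]
  rw [← Finset.prod_filter, Finset.prod_const]

lemma ilace_iff {μ κ : ℕ → ℕ} (h : IsSP μ) (h' : IsSP κ) {B : ℕ} (hB : μ 0 ≤ B) (hB' : κ 0 ≤ B) :
    Ilace μ κ ↔ ∀ p ∈ Finset.Icc 1 B, cn (prt B μ) B p - cn (prt B κ) B p = 0 ∨
      cn (prt B μ) B p - cn (prt B κ) B p = 1 := by
  constructor
  · intro hi p hp
    obtain ⟨n, hn, -, hs⟩ := cn_spec h hB (Finset.mem_Icc.mp hp).1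
    obtain ⟨n', hn', -, hs'⟩ := cn_spec h' hB' (Finset.mem_Icc.mp hp).1
    rw [hn, hn']
    have h1 : n' ≤ n := by
      by_contra hc
      have e1 := (hs' n).2 (by omega)
      have e2 := (hi n).1
      have e3 := (hs n).1 (by omega)
      omega
    have h2 : n ≤ n' + 1 := by
      by_contra hc
      have e1 := (hs (n' + 1)).2 (by omega)
      have e2 := (hi n').2
      have e3 := (hs' n').1 (by omega)
      omega
    omega
  · intro hi i
    constructor
    · rcases Nat.eq_zero_or_pos (κ i) with h0 | h0
      · omega
      · have e0 := h'.anti (Nat.zero_le i)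
        have hp : κ i ∈ Finset.Icc 1 B := by simp; omega
        obtain ⟨n, hn, -, hs⟩ := cn_spec h hB (Finset.mem_Icc.mp hp).1
        obtain ⟨n', hn', -, hs'⟩ := cn_spec h' hB' (Finset.mem_Icc.mp hp).1
        have e1 := hi _ hp
        rw [hn, hn'] at e1
        have e2 := (hs' i).1 le_rfl
        exact (hs i).2 (by omega)
    · rcases Nat.eq_zero_or_pos (μ (i + 1)) with h0 | h0
      · omega
      · have e0 := h.anti (Nat.zero_le (i + 1))
        have hp : μ (i + 1) ∈ Finset.Icc 1 B := by simp; omega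
        obtain ⟨n, hn, -, hs⟩ := cn_spec h hB (Finset.mem_Icc.mp hp).1
        obtain ⟨n', hn', -, hs'⟩ := cn_spec h' hB' (Finset.mem_Icc.mp hp).1
        have e1 := hi _ hp
        rw [hn, hn'] at e1
        have e2 := (hs (i + 1)).1 le_rfl
        exact (hs' i).2 (by omega)

lemma prt_inj {μ κ : ℕ → ℕ} (h : IsSP μ) (h' : IsSP κ) {B : ℕ} (hB : μ 0 ≤ B) (hB' : κ 0 ≤ B)
    (he : prt B μ = prt B κ) : μ = κ := by
  have key : ∀ i p, 1 ≤ p → (p ≤ μ i ↔ p ≤ κ i) := by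
    intro i p hp
    obtain ⟨n, hn, -, hs⟩ := cn_spec h hB hp
    obtain ⟨n', hn', -, hs'⟩ := cn_spec h' hB' hp
    rw [he, hn'] at hn
    have : n' = n := by exact_mod_cast hn
    rw [hs, hs', this]
  funext i
  have h1 := key i (μ i)
  have h2 := key i (κ i)
  omega

lemma prt_surj (B : ℕ) : ∀ K ⊆ Finset.Icc 1 B, ∃ κ, IsSP κ ∧ κ 0 ≤ B ∧
    ∀ p, 0 < p → ((∃ i, κ i = p) ↔ p ∈ K) := by
  induction B with
  | zero =>
    intro K hK
    refine ⟨fun _ => 0, ⟨by simp, by simp⟩, le_rfl, fun p hp => ?_⟩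
    have : p ∉ K := fun h => by
      have := Finset.mem_Icc.mp (hK h)
      omega
    simp [this]
    omega
  | succ B ih =>
    intro K hK
    obtain ⟨κ, h1, h2, h3⟩ := ih (K.erase (B + 1)) (by
      intro q hq
      have e1 := Finset.mem_erase.mp hq
      have e2 := Finset.mem_Icc.mp (hK e1.2)
      simp
      omega)
    by_cases hB : B + 1 ∈ K
    · refine ⟨fun i => Nat.casesOn i (B + 1) κ, ⟨?_, ?_⟩, le_rfl, ?_⟩
      · rintro (_ | i) hi
        · show κ 0 < B + 1
          omega
        · exact h1.1 i hi
      · rintro (_ | i) hi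
        · simp at hi
        · exact h1.2 i hi
      · intro p hp
        have h4 := h3 p hp
        rw [Finset.mem_erase] at h4
        constructor
        · rintro ⟨_ | i, hi⟩
          · have hi' : B + 1 = p := hi
            rwa [← hi']
          · exact (h4.1 ⟨i, hi⟩).2
        · intro hpK
          by_cases hpB : p = B + 1
          · exact ⟨0, hpB.symm⟩
          · obtain ⟨i, hi⟩ := h4.2 ⟨hpB, hpK⟩
            exact ⟨i + 1, hi⟩
    · refine ⟨κ, h1, by omega, fun p hp => ?_⟩
      rw [h3 p hp, Finset.erase_eq_of_notMem hB]

lemma gw_pow (x : ℚ) {e : ℤ} (h : e = 0 ∨ e = 1) : gw x e = x ^ e.toNat := by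
  rcases h with rfl | rfl <;> simp [gw]

lemma gw_prod (x : ℚ) {μ κ : ℕ → ℕ} (h : IsSP μ) (h' : IsSP κ) {B : ℕ} (hB : μ 0 ≤ B)
    (hB' : κ 0 ≤ B) (hi : Ilace μ κ) :
    ∏ p ∈ Finset.Icc 1 B, gw x (0 + cn (prt B μ) B p - cn (prt B κ) B p) =
      x ^ (wt μ - wt κ) := by
  have hh := (ilace_iff h h' hB hB').1 hi
  simp only [zero_add]
  rw [Finset.prod_congr rfl fun p hp => gw_pow x (hh p hp), Finset.prod_pow_eq_pow_sum]
  congr 1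
  have h1 : ((∑ p ∈ Finset.Icc 1 B, (cn (prt B μ) B p - cn (prt B κ) B p).toNat : ℕ) : ℤ) =
      wt μ - wt κ := by
    rw [wt_eq_s7 h hB, wt_eq_s7 h' hB', ← Finset.sum_sub_distrib]
    push_cast
    refine Finset.sum_congr rfl fun p hp => ?_
    have := hh p hp
    omega
  omega

lemma gw_ne {x : ℚ} {e : ℤ} (h : gw x e ≠ 0) : e = 0 ∨ e = 1 := by
  unfold gw at h
  by_contra hc
  push Not at hc
  simp [hc.1, hc.2] at h

lemma G_eq (μ ν : ℕ → ℕ) (hμ : IsSP μ) (hν : IsSP ν) (x y : ℚ) (B : ℕ) (hB : μ 0 ≤ B)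
    (hB' : ν 0 ≤ B) :
    (∑ᶠ κ ∈ {κ : ℕ → ℕ | IsSP κ ∧ Ilace μ κ ∧ Ilace κ ν},
        (2 : ℚ) ^ (dpart μ κ + dpart κ ν) * x ^ (wt μ - wt κ) * y ^ (wt κ - wt ν))
      = Tr x y (prt B μ) (prt B ν) B 0 0 := by
  let good : Finset ℕ → Prop := fun K => ∀ p ∈ Finset.Icc 1 B,
    (cn (prt B μ) B p - cn K B p = 0 ∨ cn (prt B μ) B p - cn K B p = 1) ∧
    (cn K B p - cn (prt B ν) B p = 0 ∨ cn K B p - cn (prt B ν) B p = 1)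
  have hbd : ∀ κ, Ilace μ κ → κ 0 ≤ B := fun κ h => (h 0).1.trans hB
  have hgood : ∀ κ, IsSP κ → κ 0 ≤ B → (good (prt B κ) ↔ Ilace μ κ ∧ Ilace κ ν) := by
    intro κ h1 h2
    rw [ilace_iff hμ h1 hB h2, ilace_iff h1 hν h2 hB']
    exact ⟨fun h => ⟨fun p hp => (h p hp).1, fun p hp => (h p hp).2⟩,
      fun h p hp => ⟨h.1 p hp, h.2 p hp⟩⟩
  rw [finsum_mem_eq_of_bijOn (t := (((Finset.Icc 1 B).powerset.filter good : Finset _) : Set _))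
    (g := fun K => trm x y (prt B μ) (prt B ν) K B 0 0) (prt B)]
  · rw [finsum_mem_coe_finset, Tr]
    refine Finset.sum_filter_of_ne fun K hK hne p hp => ?_
    unfold trm at hne
    have h1 := Finset.prod_ne_zero_iff.mp hne p hp
    have h2 := gw_ne (right_ne_zero_of_mul h1)
    have h3 := gw_ne (right_ne_zero_of_mul (left_ne_zero_of_mul h1))
    simp only [zero_add] at h2 h3
    exact ⟨h3, h2⟩
  · refine ⟨?_, ?_, ?_⟩
    · rintro κ ⟨h1, h2, h3⟩
      simp only [Finset.coe_filter, Set.mem_ofPred_eq, Finset.mem_powerset]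
      exact ⟨Finset.filter_subset _ _, (hgood κ h1 (hbd κ h2)).2 ⟨h2, h3⟩⟩
    · rintro κ ⟨h1, h2, h3⟩ κ' ⟨h1', h2', h3'⟩ he
      exact prt_inj h1 h1' (hbd _ h2) (hbd _ h2') he
    · intro K hK
      simp only [Finset.coe_filter, Set.mem_ofPred_eq, Finset.mem_powerset] at hK
      obtain ⟨κ, h1, h2, h3⟩ := prt_surj B K hK.1
      have he : prt B κ = K := by
        ext p
        simp only [prt, Finset.mem_filter]
        constructor
        · rintro ⟨hp, h⟩
          exact (h3 p (Finset.mem_Icc.mp hp).1).1 h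
        · intro hp
          have := hK.1 hp
          exact ⟨this, (h3 p (Finset.mem_Icc.mp this).1).2 hp⟩
      exact ⟨κ, ⟨h1, (hgood κ h1 h2).1 (he ▸ hK.2)⟩, he⟩
  · rintro κ ⟨h1, h2, h3⟩
    have hb := hbd κ h2
    show _ = trm x y (prt B μ) (prt B ν) (prt B κ) B 0 0
    unfold trm
    rw [Finset.prod_mul_distrib, Finset.prod_mul_distrib, Finset.prod_mul_distrib,
      dpart_eq hμ hB, dpart_eq h1 hb, gw_prod x hμ h1 hB hb h2, gw_prod y h1 hν hb hB' h3, pow_add]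

/-- The two-variable polynomial
`G(x,y) = ∑_{μ ≻ κ ≻ ν} 2^{#(μ|κ)+#(κ|ν)} x^{|μ|-|κ|} y^{|κ|-|ν|}`
is symmetric in `x` and `y`: `G(x,y) = G(y,x)`. -/
theorem stmt7 (μ ν : ℕ → ℕ) (hμ : IsSP μ) (hν : IsSP ν) (x y : ℚ) :
    (∑ᶠ κ ∈ {κ : ℕ → ℕ | IsSP κ ∧ Ilace μ κ ∧ Ilace κ ν},
        (2 : ℚ) ^ (dpart μ κ + dpart κ ν) * x ^ (wt μ - wt κ) * y ^ (wt κ - wt ν))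
      =
    ∑ᶠ κ ∈ {κ : ℕ → ℕ | IsSP κ ∧ Ilace μ κ ∧ Ilace κ ν},
        (2 : ℚ) ^ (dpart μ κ + dpart κ ν) * y ^ (wt μ - wt κ) * x ^ (wt κ - wt ν) := by
  have hB : μ 0 ≤ max (μ 0) (ν 0) := le_max_left _ _
  have hB' : ν 0 ≤ max (μ 0) (ν 0) := le_max_right _ _
  rw [G_eq μ ν hμ hν x y _ hB hB', G_eq μ ν hμ hν y x _ hB hB']
  exact (Tr_inv x y _ _ _).1

end PaperIB
end
end

section
/- Let π be a strict plane partition given as an array: a finitely supported function π : ℤ_{>0} × ℤ_{>0} → ℕ that is weakly decreasing along rows and columns (π(i,j) ≥ π(i+1,j) and π(i,j) ≥ π(i,j+1)) and strictly decreasing along diagonals while positive (π(i,j) > π(i+1,j+1) whenever π(i,j) > 0). Let p(π) be the number of connected components of the set of cells {(i,j) : π(i,j) > 0}, where two cells are connected when they share an edge and carry equal entries. Then p(π) = ∑_{k≥1} #(π_{−k+1}|π_{−k}) + ∑_{k≥1} #(π_{k−1}|π_k) − l(π₀), where π_k denotes the k-th diagonal slice of π. Equivalently, 2^{−l(π₀)}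 · ∏_{k≥1} 2^{#(π_{−k+1}|π_{−k})} · ∏_{k≥1} 2^{#(π_{k−1}|π_k)} = 2^{p(π)}. -/
open scoped Classical

noncomputable section

namespace PaperIB

/-- Content of a cell. -/
def ctn (c : ℕ × ℕ) : ℤ := (c.2 : ℤ) - c.1

lemma sum_Ico_int (g : ℤ → ℕ) (n : ℕ) :
    ∑ k ∈ Finset.Ico (-(n : ℤ)) n, g k
      = ∑ k ∈ Finset.range n, g k + ∑ k ∈ Finset.range n, g (-(k : ℤ) - 1) := by
  induction n with
  | zero => simp
  | succ n ih =>
    have h : Finset.Ico (-((n + 1 : ℕ) : ℤ)) ((n + 1 : ℕ) : ℤ)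
        = insert (-(n : ℤ) - 1) (insert (n : ℤ) (Finset.Ico (-(n : ℤ)) n)) := by
      ext x
      simp only [Finset.mem_Ico, Finset.mem_insert]
      push_cast
      omega
    rw [h, Finset.sum_insert, Finset.sum_insert, ih, Finset.sum_range_succ,
      Finset.sum_range_succ]
    · ring
    · simp
    · simp only [Finset.mem_Ico, Finset.mem_insert]
      omega

lemma sdiff_card_diff (s t : Finset ℕ) :
    ((s \ t).card : ℤ) + t.card = (t \ s).card + s.card := by
  have h1 := Finset.card_sdiff_add_card s t
  have h2 := Finset.card_sdiff_add_card t s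
  rw [Finset.union_comm] at h2
  omega

lemma telescope (V : ℤ → Finset ℕ) (n : ℕ) :
    (∑ k ∈ Finset.range n, ((V (-(k : ℤ) - 1) \ V (-(k : ℤ))).card : ℤ)) + (V 0).card
      = (∑ k ∈ Finset.range n, ((V (-(k : ℤ)) \ V (-(k : ℤ) - 1)).card : ℤ))
        + (V (-(n : ℤ))).card := by
  induction n with
  | zero => simp
  | succ n ih =>
    rw [Finset.sum_range_succ, Finset.sum_range_succ]
    have h := sdiff_card_diff (V (-(n : ℤ) - 1)) (V (-(n : ℤ)))
    have e : -((n + 1 : ℕ) : ℤ) = -(n : ℤ) - 1 := by push_cast; ring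
    rw [e]
    linarith

section
variable (f : ℕ → ℕ → ℕ)

lemma f_anti (hrow : ∀ i j, f (i + 1) j ≤ f i j) (hcol : ∀ i j, f i (j + 1) ≤ f i j)
    {i j i' j' : ℕ} (hi : i ≤ i') (hj : j ≤ j') : f i' j' ≤ f i j :=
  le_trans (antitone_nat_of_succ_le (f := fun x => f x j') (fun n => hrow n j') hi)
    (antitone_nat_of_succ_le (f := fun x => f i x) (fun n => hcol i n) hj)

lemma f_strict (hrow : ∀ i j, f (i + 1) j ≤ f i j) (hcol : ∀ i j, f i (j + 1) ≤ f i j)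
    (hdiag : ∀ i j, 0 < f i j → f (i + 1) (j + 1) < f i j)
    {i j i' j' : ℕ} (hp : 0 < f i j) (hi : i + 1 ≤ i') (hj : j + 1 ≤ j') : f i' j' < f i j :=
  lt_of_le_of_lt (f_anti f hrow hcol hi hj) (hdiag i j hp)

lemma cell_unique (hrow : ∀ i j, f (i + 1) j ≤ f i j) (hcol : ∀ i j, f i (j + 1) ≤ f i j)
    (hdiag : ∀ i j, 0 < f i j → f (i + 1) (j + 1) < f i j)
    (c d : ℕ × ℕ) (hc : 0 < f c.1 c.2) (he : f c.1 c.2 = f d.1 d.2) (hk : ctn c = ctn d) :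
    c = d := by
  obtain ⟨i, j⟩ := c
  obtain ⟨i', j'⟩ := d
  simp only [ctn] at *
  rcases lt_trichotomy i i' with h | h | h
  · have := f_strict f hrow hcol hdiag hc (i' := i') (j' := j') (by omega) (by omega)
    omega
  · ext <;> simp <;> omega
  · have := f_strict f hrow hcol hdiag (he ▸ hc) (i' := i) (j' := j) (by omega) (by omega)
    omega

lemma cell_adj (hrow : ∀ i j, f (i + 1) j ≤ f i j) (hcol : ∀ i j, f i (j + 1) ≤ f i j)
    (hdiag : ∀ i j, 0 < f i j → f (i + 1) (j + 1) < f i j)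
    (c d : ℕ × ℕ) (hc : 0 < f c.1 c.2) (he : f c.1 c.2 = f d.1 d.2) (hk : ctn d = ctn c + 1) :
    ((c.1 = d.1 ∧ (c.2 = d.2 + 1 ∨ d.2 = c.2 + 1)) ∨
          (c.2 = d.2 ∧ (c.1 = d.1 + 1 ∨ d.1 = c.1 + 1))) := by
  obtain ⟨i, j⟩ := c
  obtain ⟨i', j'⟩ := d
  simp only [ctn] at *
  by_cases h : i + 1 ≤ i'
  · have := f_strict f hrow hcol hdiag hc (i' := i') (j' := j') (by omega) (by omega)
    omega
  by_cases h : i' + 2 ≤ i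
  · have := f_strict f hrow hcol hdiag (he ▸ hc) (i' := i) (j' := j) (by omega) (by omega)
    omega
  omega

/-- Cells that are right ends of their component. -/
def Ends : Set (ℕ × ℕ) :=
  {c | 0 < f c.1 c.2 ∧ ∀ d : ℕ × ℕ, ctn d = ctn c + 1 → f d.1 d.2 ≠ f c.1 c.2}

lemma comp_count (hfin : {c : ℕ × ℕ | 0 < f c.1 c.2}.Finite)
    (hrow : ∀ i j, f (i + 1) j ≤ f i j) (hcol : ∀ i j, f i (j + 1) ≤ f i j)
    (hdiag : ∀ i j, 0 < f i j → f (i + 1) (j + 1) < f i j)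
    (A : ℕ × ℕ → ℕ × ℕ → Prop) (hA : A = fun c d =>
      0 < f c.1 c.2 ∧ 0 < f d.1 d.2 ∧ f c.1 c.2 = f d.1 d.2 ∧
        ((c.1 = d.1 ∧ (c.2 = d.2 + 1 ∨ d.2 = c.2 + 1)) ∨
          (c.2 = d.2 ∧ (c.1 = d.1 + 1 ∨ d.1 = c.1 + 1)))) :
    Set.ncard {S : Set (ℕ × ℕ) | ∃ c : ℕ × ℕ, 0 < f c.1 c.2 ∧
      S = {d | Relation.ReflTransGen A c d}} = (Ends f).ncard := by
  have symm : Symmetric A := by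
    subst hA
    rintro c d ⟨h1, h2, h3, h4⟩
    refine ⟨h2, h1, h3.symm, ?_⟩
    omega
  have rsymm : ∀ c d, Relation.ReflTransGen A c d → Relation.ReflTransGen A d c := by
    intro c d h
    induction h with
    | refl => exact .refl
    | tail _ h ih => exact .head (symm h) ih
  have key : ∀ c ∈ Ends f, ∀ d, Relation.ReflTransGen A c d →
      f d.1 d.2 = f c.1 c.2 ∧ ctn d ≤ ctn c := by
    intro c hc d h
    induction h with
    | refl => exact ⟨rfl, le_rfl⟩
    | @tail b d _ h ih =>
      subst hA
      obtain ⟨h1, h2, h3, h4⟩ := h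
      refine ⟨h3 ▸ ih.1, ?_⟩
      have hbd : ctn d ≤ ctn b + 1 := by simp only [ctn]; omega
      by_contra hlt
      exact hc.2 d (by omega) (h3 ▸ ih.1)
  have himg : {S : Set (ℕ × ℕ) | ∃ c : ℕ × ℕ, 0 < f c.1 c.2 ∧
      S = {d | Relation.ReflTransGen A c d}}
      = (fun c => {d | Relation.ReflTransGen A c d}) '' (Ends f) := by
    ext S
    constructor
    · rintro ⟨c, hc, rfl⟩
      obtain ⟨B, hB⟩ : ∃ B : ℤ, ∀ c : ℕ × ℕ, 0 < f c.1 c.2 → ctn c ≤ B := by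
        obtain ⟨B, hB⟩ := (hfin.image ctn).bddAbove
        exact ⟨B, fun c hc => hB ⟨c, hc, rfl⟩⟩
      obtain ⟨n, hn⟩ : ∃ n : ℕ, B - ctn c < n := ⟨(B - ctn c + 1).toNat, by omega⟩
      induction n generalizing c with
      | zero => have := hB c hc; omega
      | succ n ih =>
        by_cases he : c ∈ Ends f
        · exact ⟨c, he, rfl⟩
        · have : ∃ d : ℕ × ℕ, ctn d = ctn c + 1 ∧ f d.1 d.2 = f c.1 c.2 := by
            by_contra hcon
            push Not at hcon
            exact he ⟨hc, hcon⟩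
          obtain ⟨d, hd1, hd2⟩ := this
          obtain ⟨e, he1, he2⟩ := ih d (hd2 ▸ hc) (by push_cast at hn; omega)
          refine ⟨e, he1, he2.trans ?_⟩
          have hcd : A c d := by
            subst hA
            exact ⟨hc, hd2 ▸ hc, hd2.symm,
              cell_adj f hrow hcol hdiag c d hc hd2.symm hd1⟩
          ext x
          exact ⟨fun h => .head hcd h, fun h => .head (symm hcd) h⟩
    · rintro ⟨c, hc, rfl⟩
      exact ⟨c, hc.1, rfl⟩
  rw [himg]
  apply Set.ncard_image_of_injOn
  intro c hc c' hc' heq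
  have h1 : Relation.ReflTransGen A c c' := by
    have : c' ∈ {d | Relation.ReflTransGen A c' d} := Relation.ReflTransGen.refl
    simp only at heq
    rw [← heq] at this
    exact this
  have k1 := key c hc c' h1
  have k2 := key c' hc' c (rsymm _ _ h1)
  exact cell_unique f hrow hcol hdiag c c' hc.1 k2.1 (le_antisymm k2.2 k1.2)

/-- Positive values on the diagonal of content `k`. -/
def vals (hfin : {c : ℕ × ℕ | 0 < f c.1 c.2}.Finite) (k : ℤ) : Finset ℕ :=
  (hfin.toFinset.filter (fun c => ctn c = k)).image (fun c => f c.1 c.2)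

lemma mem_vals (hfin : {c : ℕ × ℕ | 0 < f c.1 c.2}.Finite) (k : ℤ) (v : ℕ) :
    v ∈ vals f hfin k ↔ 0 < v ∧ ∃ c : ℕ × ℕ, ctn c = k ∧ f c.1 c.2 = v := by
  simp only [vals, Finset.mem_image, Finset.mem_filter, Set.Finite.mem_toFinset,
    Set.mem_setOf_eq]
  constructor
  · rintro ⟨c, ⟨h1, h2⟩, rfl⟩
    exact ⟨h1, c, h2, rfl⟩
  · rintro ⟨h, c, h2, rfl⟩
    exact ⟨c, ⟨h, h2⟩, rfl⟩

lemma ends_count (hfin : {c : ℕ × ℕ | 0 < f c.1 c.2}.Finite)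
    (hrow : ∀ i j, f (i + 1) j ≤ f i j) (hcol : ∀ i j, f i (j + 1) ≤ f i j)
    (hdiag : ∀ i j, 0 < f i j → f (i + 1) (j + 1) < f i j) (N : ℕ)
    (hN : ∀ c : ℕ × ℕ, 0 < f c.1 c.2 → -(N : ℤ) < ctn c ∧ ctn c < N) :
    (Ends f).ncard = ∑ k ∈ Finset.Ico (-(N : ℤ)) N,
      (vals f hfin k \ vals f hfin (k + 1)).card := by
  rw [← Finset.card_sigma, ← Set.ncard_coe_finset]
  rw [← Set.ncard_image_of_injOn (s := Ends f)
    (f := fun c => (⟨ctn c, f c.1 c.2⟩ : (_ : ℤ) × ℕ))]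
  · congr 1
    ext ⟨k, v⟩
    simp only [Set.mem_image, Finset.coe_sigma, Set.mem_sigma_iff, Finset.mem_coe,
      Finset.mem_Ico, Finset.mem_sdiff, mem_vals]
    constructor
    · rintro ⟨c, hc, h⟩
      simp only [Sigma.mk.injEq, heq_eq_eq] at h
      obtain ⟨rfl, rfl⟩ := h
      have := hN c hc.1
      refine ⟨⟨this.1.le, this.2⟩, ⟨hc.1, c, rfl, rfl⟩, ?_⟩
      rintro ⟨_, d, hd1, hd2⟩
      exact hc.2 d hd1 hd2
    · rintro ⟨_, ⟨hv, c, rfl, rfl⟩, hn⟩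
      exact ⟨c, ⟨hv, fun d hd1 hd2 => hn ⟨hv, d, hd1, hd2⟩⟩, rfl⟩
  · intro c hc c' hc' h
    simp only [Sigma.mk.injEq, heq_eq_eq] at h
    exact cell_unique f hrow hcol hdiag c c' hc.1 h.2 h.1

lemma slice_iff (slice : ℤ → ℕ → ℕ) (hs : slice = fun k i =>
    if 0 ≤ k then f i (i + k.toNat) else f (i + (-k).toNat) i) (k : ℤ) (v : ℕ) :
    (∃ i, slice k i = v) ↔ ∃ c : ℕ × ℕ, ctn c = k ∧ f c.1 c.2 = v := by
  subst hs
  by_cases hk : 0 ≤ k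
  · simp only [hk, if_true]
    constructor
    · rintro ⟨i, h⟩
      exact ⟨(i, i + k.toNat), by simp [ctn, hk], h⟩
    · rintro ⟨⟨i, j⟩, h, h'⟩
      simp only [ctn] at h h'
      refine ⟨i, ?_⟩
      rw [← h']
      congr 1
      omega
  · simp only [hk, if_false]
    constructor
    · rintro ⟨i, h⟩
      exact ⟨(i + (-k).toNat, i), by simp only [ctn]; omega, h⟩
    · rintro ⟨⟨i, j⟩, h, h'⟩
      simp only [ctn] at h h'
      refine ⟨j, ?_⟩
      rw [← h']
      congr 1
      omega

lemma dpart_eq_s9 (hfin : {c : ℕ × ℕ | 0 < f c.1 c.2}.Finite) (slice : ℤ → ℕ → ℕ)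
    (hs : slice = fun k i =>
      if 0 ≤ k then f i (i + k.toNat) else f (i + (-k).toNat) i) (k l : ℤ) :
    dpart (slice k) (slice l) = (vals f hfin k \ vals f hfin l).card := by
  rw [dpart, ← Set.ncard_coe_finset]
  congr 1
  ext v
  simp only [Set.mem_setOf_eq, Finset.mem_coe, Finset.mem_sdiff, mem_vals]
  rw [← slice_iff f slice hs, ← slice_iff f slice hs]
  constructor
  · rintro ⟨h1, h2, h3⟩
    exact ⟨⟨h1, h2⟩, fun ⟨_, j, hj⟩ => h3 j hj⟩
  · rintro ⟨⟨h1, h2⟩, h3⟩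
    exact ⟨h1, h2, fun j hj => h3 ⟨h1, j, hj⟩⟩

lemma len_eq (hfin : {c : ℕ × ℕ | 0 < f c.1 c.2}.Finite)
    (hrow : ∀ i j, f (i + 1) j ≤ f i j) (hcol : ∀ i j, f i (j + 1) ≤ f i j)
    (hdiag : ∀ i j, 0 < f i j → f (i + 1) (j + 1) < f i j) (slice : ℤ → ℕ → ℕ)
    (hs : slice = fun k i =>
      if 0 ≤ k then f i (i + k.toNat) else f (i + (-k).toNat) i) :
    len (slice 0) = (vals f hfin 0).card := by
  rw [len, ← Set.ncard_coe_finset, ← Set.ncard_image_of_injOn (f := slice 0)]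
  · congr 1
    ext v
    simp only [Set.mem_image, Set.mem_setOf_eq, Finset.mem_coe, mem_vals]
    rw [← slice_iff f slice hs]
    constructor
    · rintro ⟨i, h, rfl⟩
      exact ⟨h, i, rfl⟩
    · rintro ⟨h, i, rfl⟩
      exact ⟨i, h, rfl⟩
  · intro i hi i' hi' h
    subst hs
    simp only [Set.mem_setOf_eq, le_refl, if_true, Int.toNat_zero, add_zero] at hi hi' h
    have := cell_unique f hrow hcol hdiag (i, i) (i', i') hi h (by simp [ctn])
    exact congrArg Prod.fst this

end

/-- Lemma on paths in a strict plane partition (given as an array `f`, 0-indexed: the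
cell `(i,j)` of the paper, `i,j ≥ 1`, is `f (i-1) (j-1)`): the number `p(π)` of connected
components of the support — cells connected when they share an edge and carry equal
entries — satisfies
`p(π) = ∑_{k≥1} #(π_{-k+1}|π_{-k}) + ∑_{k≥1} #(π_{k-1}|π_k) - l(π₀)`,
equivalently `2^{-l(π₀)} ∏ 2^{#(π_{-k+1}|π_{-k})} ∏ 2^{#(π_{k-1}|π_k)} = 2^{p(π)}`,
where `π_k` are the diagonal slices. -/
theorem stmt9 (f : ℕ → ℕ → ℕ)
    (hfin : {c : ℕ × ℕ | 0 < f c.1 c.2}.Finite)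
    (hrow : ∀ i j, f (i + 1) j ≤ f i j)
    (hcol : ∀ i j, f i (j + 1) ≤ f i j)
    (hdiag : ∀ i j, 0 < f i j → f (i + 1) (j + 1) < f i j) :
    let A : ℕ × ℕ → ℕ × ℕ → Prop := fun c d =>
      0 < f c.1 c.2 ∧ 0 < f d.1 d.2 ∧ f c.1 c.2 = f d.1 d.2 ∧
        ((c.1 = d.1 ∧ (c.2 = d.2 + 1 ∨ d.2 = c.2 + 1)) ∨
          (c.2 = d.2 ∧ (c.1 = d.1 + 1 ∨ d.1 = c.1 + 1)))
    let p : ℕ := Set.ncard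
      {S : Set (ℕ × ℕ) | ∃ c : ℕ × ℕ, 0 < f c.1 c.2 ∧ S = {d | Relation.ReflTransGen A c d}}
    let slice : ℤ → ℕ → ℕ := fun k i => if 0 ≤ k then f i (i + k.toNat) else f (i + (-k).toNat) i
    ((p : ℤ) = (∑ᶠ k : ℕ, (dpart (slice (-(k : ℤ))) (slice (-(k : ℤ) - 1)) : ℤ))
        + (∑ᶠ k : ℕ, (dpart (slice (k : ℤ)) (slice ((k : ℤ) + 1)) : ℤ))
        - (len (slice 0) : ℤ)) ∧
      (2 : ℚ) ^ (-(len (slice 0) : ℤ)) *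
          (∏ᶠ k : ℕ, (2 : ℚ) ^ dpart (slice (-(k : ℤ))) (slice (-(k : ℤ) - 1))) *
          (∏ᶠ k : ℕ, (2 : ℚ) ^ dpart (slice (k : ℤ)) (slice ((k : ℤ) + 1)))
        = (2 : ℚ) ^ p := by
  intro A p slice
  obtain ⟨N, hN⟩ : ∃ N : ℕ, ∀ c : ℕ × ℕ, 0 < f c.1 c.2 → -(N : ℤ) < ctn c ∧ ctn c < N := by
    obtain ⟨B, hB⟩ := (hfin.image (fun c => (ctn c).natAbs)).bddAbove
    refine ⟨B + 1, fun c hc => ?_⟩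
    have : (ctn c).natAbs ≤ B := hB ⟨c, hc, rfl⟩
    omega
  have hp : p = (Ends f).ncard := comp_count f hfin hrow hcol hdiag A rfl
  have hD := dpart_eq_s9 f hfin slice rfl
  have hL : len (slice 0) = _ := len_eq f hfin hrow hcol hdiag slice rfl
  have hempty : ∀ k : ℤ, (k ≤ -N ∨ N ≤ k) → vals f hfin k = ∅ := by
    intro k hk
    rw [Finset.eq_empty_iff_forall_notMem]
    intro v hv
    rw [mem_vals] at hv
    obtain ⟨h, c, hc, rfl⟩ := hv
    have := hN c h
    omega
  rw [ends_count f hfin hrow hcol hdiag N hN, sum_Ico_int] at hp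
  have tele := telescope (vals f hfin) N
  rw [hempty (-(N : ℤ)) (Or.inl le_rfl)] at tele
  simp only [hD, hL]
  have e1 : ∀ k : ℕ, N ≤ k →
      (vals f hfin (-(k : ℤ)) \ vals f hfin (-(k : ℤ) - 1)).card = 0 := by
    intro k hk
    rw [hempty (-(k : ℤ)) (Or.inl (by omega))]
    simp
  have e2 : ∀ k : ℕ, N ≤ k →
      (vals f hfin (k : ℤ) \ vals f hfin ((k : ℤ) + 1)).card = 0 := by
    intro k hk
    rw [hempty (k : ℤ) (Or.inr (by omega))]
    simp
  have hsum : ∀ g : ℕ → ℕ, (∀ k, N ≤ k → g k = 0) →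
      ∑ᶠ k : ℕ, (g k : ℤ) = ∑ k ∈ Finset.range N, (g k : ℤ) := by
    intro g hg
    apply finsum_eq_sum_of_support_subset
    intro k hk
    simp only [Function.mem_support] at hk
    simp only [Finset.coe_range, Set.mem_Iio]
    by_contra hlt
    exact hk (by simp [hg k (by omega)])
  have hprod : ∀ g : ℕ → ℕ, (∀ k, N ≤ k → g k = 0) →
      ∏ᶠ k : ℕ, (2 : ℚ) ^ g k = 2 ^ (∑ k ∈ Finset.range N, g k) := by
    intro g hg
    rw [← Finset.prod_pow_eq_pow_sum]
    apply finprod_eq_prod_of_mulSupport_subset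
    intro k hk
    simp only [Function.mem_mulSupport] at hk
    simp only [Finset.coe_range, Set.mem_Iio]
    by_contra hlt
    exact hk (by simp [hg k (by omega)])
  have hmain : (p : ℤ) = (∑ k ∈ Finset.range N,
        ((vals f hfin (-(k : ℤ)) \ vals f hfin (-(k : ℤ) - 1)).card : ℤ))
      + (∑ k ∈ Finset.range N, ((vals f hfin (k : ℤ) \ vals f hfin ((k : ℤ) + 1)).card : ℤ))
      - ((vals f hfin 0).card : ℤ) := by
    rw [hp]
    simp only [sub_add_cancel]
    push_cast
    simp only [Finset.card_empty, Nat.cast_zero, add_zero] at tele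
    linarith
  constructor
  · rw [hsum _ e1, hsum _ e2]
    exact hmain
  · rw [hprod _ e1, hprod _ e2, ← zpow_natCast, ← zpow_natCast, ← zpow_natCast,
      ← zpow_add₀ two_ne_zero, ← zpow_add₀ two_ne_zero]
    congr 1
    rw [hmain]
    push_cast
    ring

end PaperIB
end
end

section
/- Let M ≥ 1 and let m, n : {0,1,…,M} → ℕ be occupation sequences with m_i ≤ 1 and n_i ≤ 1 for all 1 ≤ i ≤ M (m₀ and n₀ arbitrary in ℕ). Suppose m is admissible to n, i.e., ∑_{k=0}^{M} (m_k − n_k) = 1 and 0 ≤ ∑_{k=i}^{M} (m_k − n_k) ≤ 1 for every 1 ≤ i ≤ M. Let μ be the strict partition whose parts are the indices i ∈ {1,…,M} with m_i = 1 (in decreasing order), and let ν be the strict partition similarly obtained from n. Then μ interlaces ν: μ₁ ≥ ν₁ ≥ μ₂ ≥ ν₂ ≥ ⋯. -/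
open scoped Classical

noncomputable section

namespace PaperIB

theorem sp_count (M : ℕ) (m : ℕ → ℕ) (hm : ∀ i, 1 ≤ i → i ≤ M → m i ≤ 1)
    (μ : ℕ → ℕ) (hμ : IsSP μ)
    (hμm : ∀ p, (0 < p ∧ ∃ j, μ j = p) ↔ (1 ≤ p ∧ p ≤ M ∧ m p = 1)) :
    ∀ d p, p + d = M + 1 → 1 ≤ p → ∀ i, i < ∑ k ∈ Finset.Icc p M, m k ↔ p ≤ μ i := by
  have hanti : Antitone μ := antitone_nat_of_succ_le (fun i => by
    rcases Nat.eq_zero_or_pos (μ i) with h | h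
    · rw [hμ.2 i h]; exact Nat.zero_le _
    · exact (hμ.1 i h).le)
  intro d
  induction d with
  | zero =>
    intro p hp h1 i
    rw [Finset.Icc_eq_empty (by omega), Finset.sum_empty]
    constructor
    · intro h; omega
    · intro h
      have := ((hμm (μ i)).1 ⟨by omega, i, rfl⟩).2.1
      omega
  | succ d ih =>
    intro p hp h1 i
    have ih' := ih (p + 1) (by omega) (by omega)
    have hs : ∑ k ∈ Finset.Icc p M, m k = m p + ∑ k ∈ Finset.Icc (p + 1) M, m k := by
      rw [← Finset.add_sum_Ioc_eq_sum_Icc (by omega : p ≤ M)]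
      have e : Finset.Ioc p M = Finset.Icc (p + 1) M := by
        ext x
        simp only [Finset.mem_Ioc, Finset.mem_Icc]
        omega
      rw [e]
    rw [hs]
    have hmp := hm p h1 (by omega)
    by_cases h : m p = 1
    · obtain ⟨-, j, hj⟩ := (hμm p).2 ⟨h1, by omega, h⟩
      have a1 := ih' j
      have a2 : ∑ k ∈ Finset.Icc (p + 1) M, m k = j := by
        rcases j with _ | j
        · omega
        · have b := ih' j
          have c : p < μ j := by
            rcases Nat.eq_zero_or_pos (μ j) with h0 | h0
            · have := hμ.2 j h0
              omega
            · have := hμ.1 j h0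
              omega
          omega
      rw [a2, h]
      constructor
      · intro hi
        have := hanti (show i ≤ j by omega)
        omega
      · intro hi
        by_contra hc
        have := hanti (show j + 1 ≤ i by omega)
        have := hμ.1 j (by omega)
        omega
    · have h0 : m p = 0 := by omega
      have hne : μ i ≠ p := fun e => h ((hμm p).1 ⟨h1, i, e⟩).2.2
      have := ih' i
      rw [h0]
      omega

/-- Admissibility of occupation sequences implies interlacing of the associated strict
partitions: if `m` is admissible to `n` (total difference `1`, all tail partial
differences in `{0,1}`), and `μ`, `ν` are the strict partitions whose parts are the
indices `i ∈ {1,…,M}` with `m i = 1`, resp. `n i = 1`, then `μ ≻ ν`. -/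
theorem stmt10 (M : ℕ) (hM : 1 ≤ M) (m n : ℕ → ℕ)
    (hm : ∀ i, 1 ≤ i → i ≤ M → m i ≤ 1) (hn : ∀ i, 1 ≤ i → i ≤ M → n i ≤ 1)
    (hsum : ∑ k ∈ Finset.range (M + 1), ((m k : ℤ) - (n k : ℤ)) = 1)
    (hpartial : ∀ i, 1 ≤ i → i ≤ M →
      0 ≤ ∑ k ∈ Finset.Icc i M, ((m k : ℤ) - (n k : ℤ)) ∧
        ∑ k ∈ Finset.Icc i M, ((m k : ℤ) - (n k : ℤ)) ≤ 1)
    (μ ν : ℕ → ℕ) (hμ : IsSP μ) (hν : IsSP ν)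
    (hμm : ∀ p, (0 < p ∧ ∃ j, μ j = p) ↔ (1 ≤ p ∧ p ≤ M ∧ m p = 1))
    (hνn : ∀ p, (0 < p ∧ ∃ j, ν j = p) ↔ (1 ≤ p ∧ p ≤ M ∧ n p = 1)) :
    Ilace μ ν := by
  have A := sp_count M m hm μ hμ hμm
  have B := sp_count M n hn ν hν hνn
  have key : ∀ p, 1 ≤ p → p ≤ M →
      ∑ k ∈ Finset.Icc p M, n k ≤ ∑ k ∈ Finset.Icc p M, m k ∧
      ∑ k ∈ Finset.Icc p M, m k ≤ ∑ k ∈ Finset.Icc p M, n k + 1 := by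
    intro p h1 h2
    have h := hpartial p h1 h2
    rw [Finset.sum_sub_distrib] at h
    zify
    constructor <;> linarith [h.1, h.2]
  intro i
  constructor
  · rcases Nat.eq_zero_or_pos (ν i) with h | h
    · omega
    · have hM' := ((hνn (ν i)).1 ⟨h, i, rfl⟩).2.1
      have k := key _ h hM'
      have b := (B (M + 1 - ν i) (ν i) (by omega) h i).2 le_rfl
      exact (A (M + 1 - ν i) (ν i) (by omega) h i).1 (by omega)
  · rcases Nat.eq_zero_or_pos (μ (i + 1)) with h | h
    · omega
    · have hM' := ((hμm (μ (i + 1))).1 ⟨h, i + 1, rfl⟩).2.1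
      have k := key _ h hM'
      have b := (A (M + 1 - μ (i + 1)) (μ (i + 1)) (by omega) h (i + 1)).2 le_rfl
      exact (B (M + 1 - μ (i + 1)) (μ (i + 1)) (by omega) h i).1 (by omega)

end PaperIB
end
end

section
/- Let R be a commutative ring, s ∈ R a unit, and M ≥ 1. Let m, n : {0,1,…,M} → ℕ. For 0 ≤ i ≤ M define the 2×2 matrix A_i over R by: A_i = diag(s⁻¹, s) if m_i = n_i; A_i = E₁₂ (the matrix unit with a single 1 in position (1,2)) if m_i = n_i + 1; A_i = E₂₁ if m_i + 1 = n_i; and A_i = 0 otherwise. Assume ∑_{k=0}^{M} (m_k − n_k) = 1. Then the (1,2)-entry of the ordered product A_M A_{M−1} ⋯ A_1 A_0 equals s^{2·∑_{i=0}^{M} i·(m_i − n_i) − M} if 0 ≤ ∑_{k=i}^{M} (m_k − n_k) ≤ 1 for every 1 ≤ i ≤ M, and equals 0 otherwise. -/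
open scoped Classical

noncomputable section

namespace PaperIB

lemma aux (R : Type*) [CommRing R] (s : Rˣ) (m n : ℕ → ℕ) (A : ℕ → Matrix (Fin 2) (Fin 2) R)
    (hA : A = fun i =>
      if m i = n i then Matrix.of ![![((s⁻¹ : Rˣ) : R), 0], ![0, (s : R)]]
      else if m i = n i + 1 then Matrix.of ![![0, 1], ![0, 0]]
      else if n i = m i + 1 then Matrix.of ![![0, 0], ![1, 0]]
      else 0) (S T : ℕ → ℤ) (hS0 : S 0 = 0) (hT0 : T 0 = 0)
    (hS : ∀ i, S (i + 1) = S i + ((m i : ℤ) - n i))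
    (hT : ∀ i, T (i + 1) = T i + (i : ℤ) * ((m i : ℤ) - n i)) (L : ℕ) :
    (((List.range L).reverse.map A).prod 0 1 =
      if (∀ j ≤ L, 0 ≤ S j ∧ S j ≤ 1) ∧ S L = 1 then
        ((s ^ ((L : ℤ) - (2 * L - 1) * S L + 2 * T L) : Rˣ) : R) else 0) ∧
    (((List.range L).reverse.map A).prod 1 1 =
      if (∀ j ≤ L, 0 ≤ S j ∧ S j ≤ 1) ∧ S L = 0 then
        ((s ^ ((L : ℤ) - (2 * L - 1) * S L + 2 * T L) : Rˣ) : R) else 0) := by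
  induction L with
  | zero => simp [hS0, hT0]
  | succ L ih =>
    obtain ⟨ih0, ih1⟩ := ih
    have hsplit : (∀ j ≤ L + 1, 0 ≤ S j ∧ S j ≤ 1) ↔
        (∀ j ≤ L, 0 ≤ S j ∧ S j ≤ 1) ∧ (0 ≤ S (L + 1) ∧ S (L + 1) ≤ 1) := by
      constructor
      · intro h
        exact ⟨fun j hj => h j (by omega), h _ le_rfl⟩
      · rintro ⟨h1, h2⟩ j hj
        rcases Nat.lt_or_ge L j with h | h
        · have : j = L + 1 := by omega
          subst this; exact h2
        · exact h1 j h
    have hE : ((L + 1 : ℕ) : ℤ) - (2 * ((L + 1 : ℕ) : ℤ) - 1) * S (L + 1) + 2 * T (L + 1) =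
        ((L : ℤ) - (2 * L - 1) * S L + 2 * T L) + (1 - 2 * S L - ((m L : ℤ) - n L)) := by
      rw [hS, hT]; push_cast; ring
    rw [List.range_succ, List.reverse_append, List.map_append, List.prod_append]
    simp only [List.reverse_singleton, List.map_singleton, List.prod_singleton,
      Matrix.mul_apply, Fin.sum_univ_two]
    rw [ih0, ih1, hE]
    simp only [hsplit]
    generalize (L : ℤ) - (2 * L - 1) * S L + 2 * T L = E
    have hSL := hS L
    by_cases hg : ∀ j ≤ L, 0 ≤ S j ∧ S j ≤ 1
    swap
    · simp [hg]
    have hb := hg L le_rfl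
    simp only [eq_true hg, true_and]
    have hc : S L = 0 ∨ S L = 1 := by omega
    rw [hA]
    by_cases h1 : m L = n L
    · have h2 : S (L + 1) = S L := by omega
      rcases hc with hc | hc <;> simp [h1, h2, hc, zpow_add, zpow_sub, mul_comm]
    by_cases h2 : m L = n L + 1
    · have h3 : S (L + 1) = S L + 1 := by omega
      rcases hc with hc | hc <;> simp [h2, h3, hc]
    by_cases h3 : n L = m L + 1
    · have h4 : S (L + 1) = S L - 1 := by omega
      have h6 : ¬ (m L = m L + 1 + 1) := by omega
      rcases hc with hc | hc <;> simp [h3, h4, hc, h6]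
    · have h5 : ¬ (0 ≤ S (L + 1) ∧ S (L + 1) ≤ 1) := by omega
      simp [h1, h2, h3, h5]


/-- The matrix-element computation for the creation operator of the generalized i-boson
model: with `A_i = diag(s⁻¹,s)`, `E₁₂`, `E₂₁` or `0` according to `m_i = n_i`,
`m_i = n_i + 1`, `m_i + 1 = n_i` or otherwise, and assuming `∑_{k=0}^{M}(m_k - n_k) = 1`,
the `(1,2)`-entry of `A_M ⋯ A_1 A_0` equals `s^{2 ∑ i (m_i - n_i) - M}` if all tail
partial sums `∑_{k=i}^{M}(m_k - n_k)` for `1 ≤ i ≤ M` lie in `{0,1}`, and `0` otherwise. -/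
theorem stmt11 (R : Type*) [CommRing R] (s : Rˣ) (M : ℕ) (hM : 1 ≤ M) (m n : ℕ → ℕ)
    (hsum : ∑ k ∈ Finset.range (M + 1), ((m k : ℤ) - (n k : ℤ)) = 1) :
    let A : ℕ → Matrix (Fin 2) (Fin 2) R := fun i =>
      if m i = n i then Matrix.of ![![((s⁻¹ : Rˣ) : R), 0], ![0, (s : R)]]
      else if m i = n i + 1 then Matrix.of ![![0, 1], ![0, 0]]
      else if n i = m i + 1 then Matrix.of ![![0, 0], ![1, 0]]
      else 0
    let P : Matrix (Fin 2) (Fin 2) R := ((List.range (M + 1)).reverse.map A).prod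
    let e : ℤ := 2 * (∑ i ∈ Finset.range (M + 1), (i : ℤ) * ((m i : ℤ) - (n i : ℤ))) - M
    ((∀ i, 1 ≤ i → i ≤ M →
        0 ≤ ∑ k ∈ Finset.Icc i M, ((m k : ℤ) - (n k : ℤ)) ∧
          ∑ k ∈ Finset.Icc i M, ((m k : ℤ) - (n k : ℤ)) ≤ 1) →
        P 0 1 = ((s ^ e : Rˣ) : R)) ∧
      ((¬ ∀ i, 1 ≤ i → i ≤ M →
          0 ≤ ∑ k ∈ Finset.Icc i M, ((m k : ℤ) - (n k : ℤ)) ∧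
            ∑ k ∈ Finset.Icc i M, ((m k : ℤ) - (n k : ℤ)) ≤ 1) →
        P 0 1 = 0) := by
  intro A P e
  have key := (aux R s m n A rfl (fun L => ∑ k ∈ Finset.range L, ((m k : ℤ) - (n k : ℤ)))
    (fun L => ∑ k ∈ Finset.range L, (k : ℤ) * ((m k : ℤ) - (n k : ℤ))) (by simp) (by simp)
    (fun i => Finset.sum_range_succ _ _) (fun i => Finset.sum_range_succ _ _) (M + 1)).1
  have htail : ∀ i ≤ M, ∑ k ∈ Finset.range i, ((m k : ℤ) - (n k : ℤ)) +
      ∑ k ∈ Finset.Icc i M, ((m k : ℤ) - (n k : ℤ)) = 1 := by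
    intro i hi
    have hI : Finset.Icc i M = Finset.Ico i (M + 1) := by ext; simp
    rw [hI, Finset.sum_range_add_sum_Ico _ (by omega), hsum]
  have hiff : (∀ i, 1 ≤ i → i ≤ M →
        0 ≤ ∑ k ∈ Finset.Icc i M, ((m k : ℤ) - (n k : ℤ)) ∧
          ∑ k ∈ Finset.Icc i M, ((m k : ℤ) - (n k : ℤ)) ≤ 1) ↔
      (∀ j ≤ M + 1, 0 ≤ ∑ k ∈ Finset.range j, ((m k : ℤ) - (n k : ℤ)) ∧
        ∑ k ∈ Finset.range j, ((m k : ℤ) - (n k : ℤ)) ≤ 1) := by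
    constructor
    · intro h j hj
      rcases Nat.eq_zero_or_pos j with h0 | h0
      · subst h0; simp
      rcases Nat.lt_or_ge M j with h1 | h1
      · have : j = M + 1 := by omega
        subst this; rw [hsum]; simp
      · have := h j h0 h1
        have := htail j h1
        omega
    · intro h i _ hi
      have := h i (by omega)
      have := htail i hi
      omega
  rw [hiff]
  simp only [hsum] at key
  constructor
  · intro h
    rw [if_pos ⟨h, trivial⟩] at key
    refine key.trans ?_
    congr 2
    simp only [e]; push_cast; ring
  · intro h
    rw [if_neg (fun h' => h h'.1)] at key
    exact key

end PaperIB
end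
end
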